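/- arXiv:0902.2467 — 2 statements merged into one kernel-verified Lean document; each statement's English description precedes it below -/
import Mathlib

section
/- Let T be a k-algebra of finite transcendence degree over k which is an integral domain, M a maximal ideal of T, K = T/M, φ : T → K the canonical surjection, D a subring of K with t.d.(K:D) ≤ 2, and A := φ^{-1}(D), where t.d.(K:D) denotes the transcendence degree of K over the quotient field of D. If T and D are AF-domains, then A is a GAF-domain; that is, for every k-algebra B of finite transcendence degree over k and every prime ideal P of A⊗_kB with p = P∩A and q = P∩B, ht(P) = ht(p⊗_kB + A⊗_kq) + ht(P/(p⊗_kB + A⊗_kq)). -/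
open TensorProduct

noncomputable section

/-- Transcendence degree of the `R`-algebra `A` as a cardinal: the supremum of the
cardinalities of algebraically independent subsets of `A` over `R`. -/
def trdegC (R A : Type*) [CommRing R] [CommRing A] [Algebra R A] : Cardinal :=
  ⨆ s : { s : Set A // AlgebraicIndependent R ((↑) : s → A) }, Cardinal.mk s.1

/-- Transcendence degree of the `R`-algebra `A`, as an extended natural number. -/
def eTrdeg (R A : Type*) [CommRing R] [CommRing A] [Algebra R A] : ℕ∞ :=
  Cardinal.toENat (trdegC R A)

/-- Height of an ideal: the infimum of the heights of the prime ideals containing it,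
the height of a prime being taken in the prime spectrum ordered by inclusion. -/
def idealHt {R : Type*} [CommRing R] (I : Ideal R) : ℕ∞ :=
  ⨅ P : { P : PrimeSpectrum R // I ≤ P.asIdeal }, Order.height P.1

/-- The extension `p[n]` of an ideal `p` of `A` to the polynomial ring
`A[X_1, ..., X_n]`. -/
def polyExt {A : Type*} [CommRing A] (n : ℕ) (p : Ideal A) : Ideal (MvPolynomial (Fin n) A) :=
  p.map (MvPolynomial.C : A →+* MvPolynomial (Fin n) A)

/-- An AF-domain over `k`: a `k`-algebra which is an integral domain such that
`ht p + t.d.(A/p) = t.d.(A)` for every prime ideal `p` of `A`. -/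
def IsAFDomain (k A : Type*) [Field k] [CommRing A] [IsDomain A] [Algebra k A] : Prop :=
  ∀ p : Ideal A, p.IsPrime → idealHt p + eTrdeg k (A ⧸ p) = eTrdeg k A

/-- A GAF-domain over `k`: for every `k`-algebra `B` (of finite transcendence degree)
and every prime `P` of `A ⊗[k] B` with `p = P ∩ A`, `q = P ∩ B`,
`ht P = ht (p⊗B + A⊗q) + ht (P/(p⊗B + A⊗q))`. -/
def IsGAFDomain (k A : Type) [Field k] [CommRing A] [IsDomain A] [Algebra k A] : Prop :=
  ∀ (B : Type) (_ : CommRing B) (_ : Algebra k B), eTrdeg k B ≠ ⊤ →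
    ∀ P : Ideal (A ⊗[k] B), P.IsPrime →
      ∀ p : Ideal A,
        p = P.comap (Algebra.TensorProduct.includeLeft : A →ₐ[k] A ⊗[k] B).toRingHom →
      ∀ q : Ideal B,
        q = P.comap (Algebra.TensorProduct.includeRight : B →ₐ[k] A ⊗[k] B).toRingHom →
      idealHt P =
        idealHt (p.map (Algebra.TensorProduct.includeLeft : A →ₐ[k] A ⊗[k] B).toRingHom ⊔
                 q.map (Algebra.TensorProduct.includeRight : B →ₐ[k] A ⊗[k] B).toRingHom) +
        idealHt (P.map (Ideal.Quotient.mk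
          (p.map (Algebra.TensorProduct.includeLeft : A →ₐ[k] A ⊗[k] B).toRingHom ⊔
           q.map (Algebra.TensorProduct.includeRight : B →ₐ[k] A ⊗[k] B).toRingHom)))

universe u v

/-- `PrimeChain I n J`: there is a chain of primes `I ≤ J₀ < J₁ < ⋯ < Jₙ = J`. -/
def PrimeChain {R : Type*} [CommRing R] (I : Ideal R) : ℕ → Ideal R → Prop
  | 0, J => J.IsPrime ∧ I ≤ J
  | n + 1, J => J.IsPrime ∧ ∃ J', J' < J ∧ PrimeChain I n J'

namespace PrimeChain

variable {R : Type*} [CommRing R] {S : Type*} [CommRing S] {I I' J J' : Ideal R} {n m : ℕ}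

theorem isPrime : ∀ {n : ℕ} {J : Ideal R}, PrimeChain I n J → J.IsPrime
  | 0, _, h => h.1
  | _ + 1, _, h => h.1

theorem le : ∀ {n : ℕ} {J : Ideal R}, PrimeChain I n J → I ≤ J
  | 0, _, h => h.2
  | _ + 1, _, h => by
    obtain ⟨-, J', hlt, h'⟩ := h
    exact h'.le.trans hlt.le

theorem refl (hI : I.IsPrime) : PrimeChain I 0 I := ⟨hI, le_rfl⟩

theorem mono_right (h : PrimeChain I n J) (hJ' : J'.IsPrime) (hJ : J ≤ J') :
    PrimeChain I n J' := by
  cases n with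
  | zero => exact ⟨hJ', h.2.trans hJ⟩
  | succ n =>
    obtain ⟨-, K, hlt, h'⟩ := h
    exact ⟨hJ', K, hlt.trans_le hJ, h'⟩

theorem mono_left (hI : I' ≤ I) : ∀ {n : ℕ} {J : Ideal R}, PrimeChain I n J → PrimeChain I' n J
  | 0, _, h => ⟨h.1, hI.trans h.2⟩
  | _ + 1, _, h => by
    obtain ⟨hJ, J', hlt, h'⟩ := h
    exact ⟨hJ, J', hlt, mono_left hI h'⟩

theorem of_succ (h : PrimeChain I (n + 1) J) : PrimeChain I n J := by
  obtain ⟨hJ, J', hlt, h'⟩ := h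
  exact h'.mono_right hJ hlt.le

theorem of_le (h : PrimeChain I n J) (hmn : m ≤ n) : PrimeChain I m J := by
  induction n with
  | zero => obtain rfl : m = 0 := by omega
            exact h
  | succ n ih =>
    rcases Nat.lt_or_ge n m with h1 | h1
    · obtain rfl : m = n + 1 := by omega
      exact h
    · exact ih h.of_succ h1

theorem succ_of_lt (h : PrimeChain I n J) (hJ' : J'.IsPrime) (hlt : J < J') :
    PrimeChain I (n + 1) J' := ⟨hJ', J, hlt, h⟩

/-- Concatenation of prime chains. -/
theorem concat (hW : ∀ W : Ideal R, W.IsPrime → I' ≤ W → PrimeChain I n W) :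
    ∀ {m : ℕ} {J : Ideal R}, PrimeChain I' m J → PrimeChain I (n + m) J
  | 0, _, h => hW _ h.1 h.2
  | _ + 1, _, h => by
    obtain ⟨hJ, J', hlt, h'⟩ := h
    exact ⟨hJ, J', hlt, concat hW h'⟩

theorem trans (h1 : PrimeChain I n I') (h2 : PrimeChain I' m J) : PrimeChain I (n + m) J :=
  concat (fun _ hW hle => h1.mono_right hW hle) h2

/-- The bottom of a chain can be separated. -/
theorem exists_bot : ∀ {n : ℕ} {J : Ideal R}, PrimeChain I n J →
    ∃ J₀ : Ideal R, J₀.IsPrime ∧ I ≤ J₀ ∧ PrimeChain J₀ n J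
  | 0, J, h => ⟨J, h.1, h.2, refl h.1⟩
  | _ + 1, _, h => by
    obtain ⟨hJ, J', hlt, h'⟩ := h
    obtain ⟨J₀, h1, h2, h3⟩ := exists_bot h'
    exact ⟨J₀, h1, h2, hJ, J', hlt, h3⟩

theorem _root_.Ideal.comap_lt_comap_iff_of_surjective {f : R →+* S} (hf : Function.Surjective f)
    {I J : Ideal S} : I.comap f < J.comap f ↔ I < J := by
  simp only [lt_iff_le_not_ge, Ideal.comap_le_comap_iff_of_surjective f hf]

theorem _root_.Ideal.isPrime_of_comap_of_surjective {f : R →+* S} (hf : Function.Surjective f)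
    {J : Ideal S} (h : (J.comap f).IsPrime) : J.IsPrime := by
  have := Ideal.map_isPrime_of_surjective hf (I := J.comap f) (Ideal.comap_mono bot_le)
  rwa [Ideal.map_comap_of_surjective f hf] at this

theorem comap {f : R →+* S} (hf : Function.Surjective f) {I : Ideal S} :
    ∀ {n : ℕ} {J : Ideal S}, PrimeChain I n J → PrimeChain (I.comap f) n (J.comap f)
  | 0, _, h => ⟨h.1.comap f, Ideal.comap_mono h.2⟩
  | _ + 1, _, h => by
    obtain ⟨hJ, J', hlt, h'⟩ := h
    exact ⟨hJ.comap f, J'.comap f, (Ideal.comap_lt_comap_iff_of_surjective hf).2 hlt,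
      comap hf h'⟩

theorem of_comap {f : R →+* S} (hf : Function.Surjective f) {I : Ideal S} {n : ℕ} {J : Ideal S}
    (h : PrimeChain (I.comap f) n (J.comap f)) : PrimeChain I n J := by
  have aux : ∀ {J : Ideal R}, J.IsPrime → I.comap f ≤ J → ∃ J' : Ideal S, J'.IsPrime ∧
      J'.comap f = J := fun {J} hJ hle => by
    have hk : RingHom.ker f ≤ J := le_trans (Ideal.comap_mono bot_le) hle
    refine ⟨J.map f, Ideal.map_isPrime_of_surjective hf hk, ?_⟩
    rw [Ideal.comap_map_of_surjective f hf]
    exact sup_eq_left.2 hk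
  induction n generalizing J with
  | zero =>
    exact ⟨Ideal.isPrime_of_comap_of_surjective hf h.1,
      (Ideal.comap_le_comap_iff_of_surjective f hf _ _).1 h.2⟩
  | succ n ih =>
    obtain ⟨hJ, J', hlt, h'⟩ := h
    obtain ⟨L, hL, rfl⟩ := aux h'.isPrime h'.le
    exact ⟨Ideal.isPrime_of_comap_of_surjective hf hJ, L,
      (Ideal.comap_lt_comap_iff_of_surjective hf).1 hlt, ih h'⟩

theorem comap_bot {f : R →+* S} (hf : Function.Surjective f)
    {n : ℕ} {J : Ideal S} (h : PrimeChain ⊥ n J) :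
    PrimeChain (RingHom.ker f) n (J.comap f) := h.comap hf

/-- Going down for prime chains. -/
theorem lift [Algebra R S] [Algebra.HasGoingDown R S] {I : Ideal R} :
    ∀ {n : ℕ} {J : Ideal S}, J.IsPrime → PrimeChain I n (J.comap (algebraMap R S)) →
      PrimeChain (I.map (algebraMap R S)) n J
  | 0, _, hJ, h => ⟨hJ, Ideal.map_le_iff_le_comap.2 h.2⟩
  | _ + 1, J, hJ, h => by
    obtain ⟨hJ', J', hlt, h'⟩ := h
    have := h'.isPrime
    have : J.LiesOver (J.comap (algebraMap R S)) := ⟨rfl⟩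
    obtain ⟨P, hP1, hP2, hP3⟩ := Ideal.exists_ideal_lt_liesOver_of_lt J hlt
    refine ⟨hJ, P, hP1, lift hP2 ?_⟩
    have := hP3.over
    rw [Ideal.under] at this
    rwa [← this]

theorem of_strictMono {f : Ideal R → Ideal S}
    (hf : ∀ J : Ideal R, J.IsPrime → (f J).IsPrime)
    (hlt : ∀ J J' : Ideal R, J.IsPrime → J'.IsPrime → J < J' → f J < f J')
    {I' : Ideal S} (hI : ∀ J : Ideal R, J.IsPrime → I ≤ J → I' ≤ f J) :
    ∀ {n : ℕ} {J : Ideal R}, PrimeChain I n J → PrimeChain I' n (f J)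
  | 0, _, h => ⟨hf _ h.1, hI _ h.1 h.2⟩
  | _ + 1, _, h => by
    obtain ⟨hJ, J', hlt', h'⟩ := h
    exact ⟨hf _ hJ, f J', hlt _ _ h'.isPrime hJ hlt', of_strictMono hf hlt hI h'⟩

theorem le_height_iff (hJ : J.IsPrime) :
    (n : ℕ∞) ≤ Order.height (⟨J, hJ⟩ : PrimeSpectrum R) ↔ PrimeChain ⊥ n J := by
  constructor
  · intro h
    obtain ⟨p, hp, hl⟩ := Order.exists_series_of_le_height _ h
    have key : ∀ i (hi : i < p.length + 1), PrimeChain ⊥ i (p ⟨i, hi⟩).asIdeal := by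
      intro i
      induction i with
      | zero => exact fun hi => ⟨(p ⟨0, hi⟩).isPrime, bot_le⟩
      | succ i ih =>
        intro hi
        exact (ih (by omega)).succ_of_lt (p ⟨i + 1, hi⟩).isPrime
          (p.strictMono (show (⟨i, by omega⟩ : Fin (p.length + 1)) < ⟨i + 1, hi⟩ by simp))
    have h1 := key n (by omega)
    have h2 : p ⟨n, by omega⟩ = ⟨J, hJ⟩ := by
      rw [← hp]
      congr 1
      ext
      simp [hl]
    rwa [h2] at h1
  · intro h
    induction n generalizing J with
    | zero => simp
    | succ n ih =>
      obtain ⟨-, J', hlt, h'⟩ := h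
      have h1 := ih h'.isPrime h'
      refine le_trans ?_ (Order.height_add_one_le
        (a := (⟨J', h'.isPrime⟩ : PrimeSpectrum R)) (b := ⟨J, hJ⟩) hlt)
      push_cast
      gcongr

end PrimeChain

open Cardinal

/-- The transcendence degree over `k` of the quotient `R ⧸ I`, as a natural number. -/
def trd (k : Type*) {R : Type*} [Field k] [CommRing R] [Algebra k R] (I : Ideal R) : ℕ :=
  (Algebra.trdeg k (R ⧸ I)).toNat

/-- All the residue domains of `R` have finite transcendence degree over `k`. -/
class FinTr (k R : Type*) [Field k] [CommRing R] [Algebra k R] : Prop where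
  lt_aleph0 : ∀ P : Ideal R, P.IsPrime → Algebra.trdeg k (R ⧸ P) < ℵ₀

section trd

variable {k : Type*} {R R' : Type u} [Field k] [CommRing R] [Algebra k R] [CommRing R']
  [Algebra k R']

theorem FinTr.of_trdeg (h : Algebra.trdeg k R < ℵ₀) : FinTr k R :=
  ⟨fun P _ => (trdeg_le_of_surjective (Ideal.Quotient.mkₐ k P)
    (Ideal.Quotient.mkₐ_surjective k P)).trans_lt h⟩

theorem trdeg_quotient_lt (P : Ideal R) [hP : P.IsPrime] [FinTr k R] :
    Algebra.trdeg k (R ⧸ P) < ℵ₀ := FinTr.lt_aleph0 P hP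

theorem trdeg_lt [IsDomain R] [FinTr k R] : Algebra.trdeg k R < ℵ₀ := by
  rw [← (AlgEquiv.quotientBot k R).trdeg_eq]
  exact trdeg_quotient_lt ⊥

theorem trd_bot : trd k (⊥ : Ideal R) = (Algebra.trdeg k R).toNat := by
  rw [trd, (AlgEquiv.quotientBot k R).trdeg_eq]

theorem cast_trd (P : Ideal R) [P.IsPrime] [FinTr k R] :
    (trd k P : Cardinal) = Algebra.trdeg k (R ⧸ P) :=
  cast_toNat_of_lt_aleph0 (trdeg_quotient_lt P)

theorem trdeg_quotient_comap_le (f : R →ₐ[k] R') (P : Ideal R') :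
    Algebra.trdeg k (R ⧸ P.comap f) ≤ Algebra.trdeg k (R' ⧸ P) :=
  trdeg_le_of_injective (Ideal.quotientMapₐ P f le_rfl)
    (Ideal.quotientMap_injective (f := (f : R →+* R')))

theorem trd_comap_le [FinTr k R'] (f : R →ₐ[k] R') (P : Ideal R') [P.IsPrime] :
    trd k (P.comap f) ≤ trd k P :=
  toNat_le_toNat (trdeg_quotient_comap_le f P) (trdeg_quotient_lt P)

theorem trdeg_quotient_comap_of_surjective {f : R →ₐ[k] R'} (hf : Function.Surjective f)
    (P : Ideal R') :
    Algebra.trdeg k (R ⧸ P.comap f) = Algebra.trdeg k (R' ⧸ P) := by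
  refine le_antisymm (trdeg_quotient_comap_le f P)
    (trdeg_le_of_surjective (Ideal.quotientMapₐ P f le_rfl) ?_)
  exact Ideal.quotientMap_surjective (H := le_rfl (a := P.comap f)) hf

theorem trd_comap_of_surjective {f : R →ₐ[k] R'} (hf : Function.Surjective f)
    (P : Ideal R') : trd k (P.comap f) = trd k P := by
  rw [trd, trdeg_quotient_comap_of_surjective hf, trd]

theorem FinTr.of_surjective [FinTr k R] (f : R →ₐ[k] R') (hf : Function.Surjective f) :
    FinTr k R' :=
  ⟨fun P _ => (trdeg_quotient_comap_of_surjective hf P).symm ▸ trdeg_quotient_lt (P.comap f)⟩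

instance [FinTr k R] (I : Ideal R) : FinTr k (R ⧸ I) :=
  .of_surjective (Ideal.Quotient.mkₐ k I) (Ideal.Quotient.mkₐ_surjective k I)

theorem trdeg_quotient_add_one_le [IsDomain R] {P : Ideal R} [hP : P.IsPrime] (h : P ≠ ⊥) :
    Algebra.trdeg k (R ⧸ P) + 1 ≤ Algebra.trdeg k R := by
  have : FaithfulSMul k (R ⧸ P) :=
    (faithfulSMul_iff_algebraMap_injective k (R ⧸ P)).2 (algebraMap k (R ⧸ P)).injective
  obtain ⟨s, hs⟩ := exists_isTranscendenceBasis k (R ⧸ P)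
  set x : s → R := fun i => (Ideal.Quotient.mk_surjective i.1).choose with hx
  have hx' : (Ideal.Quotient.mkₐ k P) ∘ x = ((↑) : s → R ⧸ P) := by
    funext i
    exact (Ideal.Quotient.mk_surjective i.1).choose_spec
  have hind : AlgebraicIndependent k ((Ideal.Quotient.mkₐ k P) ∘ x) := hx' ▸ hs.1
  have hxi : AlgebraicIndependent k x := hind.of_comp
  obtain ⟨z, hzP, hz⟩ := Submodule.exists_mem_ne_zero_of_ne_bot h
  have htr : Transcendental (Algebra.adjoin k (Set.range x)) z := by
    intro halg
    refine Ideal.comap_ne_bot_of_algebraic_mem hz hzP halg (le_bot_iff.1 ?_)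
    rintro ⟨y, hy⟩ hyP
    rw [Algebra.adjoin_range_eq_range_aeval] at hy
    obtain ⟨f, rfl⟩ := hy
    have h1 : MvPolynomial.aeval ((Ideal.Quotient.mkₐ k P) ∘ x) f = 0 := by
      refine (MvPolynomial.comp_aeval_apply x (Ideal.Quotient.mkₐ k P) f).symm.trans ?_
      exact Ideal.Quotient.eq_zero_iff_mem.2 hyP
    have h2 : f = 0 := hind (by rw [h1, map_zero])
    exact Subtype.ext (by simp [h2])
  have := ((hxi.option_iff_transcendental z).2 htr).cardinalMk_le_trdeg
  rwa [mk_option, hs.cardinalMk_eq_trdeg] at this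

theorem trd_add_one_le [FinTr k R] {P P' : Ideal R} [P.IsPrime] [hP' : P'.IsPrime] (h : P < P') :
    trd k P' + 1 ≤ trd k P := by
  have hk : RingHom.ker (Ideal.Quotient.mk P) ≤ P' := by rw [Ideal.mk_ker]; exact h.le
  have : (P'.map (Ideal.Quotient.mk P)).IsPrime :=
    Ideal.map_isPrime_of_surjective Ideal.Quotient.mk_surjective hk
  have hc : (P'.map (Ideal.Quotient.mk P)).comap (Ideal.Quotient.mkₐ k P) = P' :=
    Ideal.comap_map_mk h.le
  have h1 := trdeg_quotient_add_one_le (k := k) (P := P'.map (Ideal.Quotient.mk P)) (by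
    rw [Ne, Ideal.map_eq_bot_iff_le_ker, Ideal.mk_ker]
    exact h.not_ge)
  rw [← trdeg_quotient_comap_of_surjective (Ideal.Quotient.mkₐ_surjective k P), hc,
    ← cast_trd P, ← cast_trd P'] at h1
  exact_mod_cast h1

theorem trd_anti [FinTr k R] {P P' : Ideal R} [P.IsPrime] [hP' : P'.IsPrime] (h : P ≤ P') :
    trd k P' ≤ trd k P := by
  rcases h.eq_or_lt with rfl | h
  · rfl
  · exact (Nat.le_succ _).trans (trd_add_one_le h)

theorem PrimeChain.trd_le [FinTr k R] {I : Ideal R} [hI : I.IsPrime] : ∀ {n : ℕ} {J : Ideal R},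
    PrimeChain I n J → n + trd k J ≤ trd k I
  | 0, J, h => by
    have := h.1
    simpa using trd_anti h.2
  | n + 1, J, h => by
    obtain ⟨hJ, J', hlt, h'⟩ := h
    have := h'.isPrime
    have h1 := PrimeChain.trd_le h'
    have h2 := trd_add_one_le (k := k) hlt
    omega

end trd

section basis

theorem exists_isTranscendenceBasis_of_adjoin_range {C A R : Type*} [CommRing C] [CommRing R]
    [IsDomain R] [Algebra C R] [FaithfulSMul C R] (f : A → R)
    (h : Algebra.adjoin C (Set.range f) = ⊤) :
    ∃ (s : Set R) (x : s → A), IsTranscendenceBasis C (f ∘ x) := by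
  have hint : Algebra.IsAlgebraic (Algebra.adjoin C (Set.range f)) R := by
    refine ⟨fun y => ?_⟩
    exact isAlgebraic_algebraMap
      (⟨y, h ▸ Algebra.mem_top⟩ : Algebra.adjoin C (Set.range f))
  obtain ⟨t, ht, htb⟩ := exists_isTranscendenceBasis_subset (R := C) (Set.range f)
  refine ⟨t, fun i => (ht i.2).choose, ?_⟩
  convert htb
  funext i
  exact (ht i.2).choose_spec

variable {C A B R : Type u} [CommRing C] [CommRing A] [CommRing B] [CommRing R]
  [Algebra C A] [Algebra C B] [Algebra C R]

theorem exists_isTranscendenceBasis_range [IsDomain R] (f : A →ₐ[C] R) (g : B →ₐ[C] R)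
    (h : f.range ⊔ g.range = ⊤) :
    ∃ (s : Set R) (x : s → A), IsTranscendenceBasis g.range (f ∘ x) := by
  refine exists_isTranscendenceBasis_of_adjoin_range f (top_le_iff.1 fun y _ => ?_)
  obtain ⟨S, hS⟩ : ∃ S : Subalgebra C R,
      ∀ y, y ∈ S ↔ y ∈ Algebra.adjoin g.range (Set.range f) :=
    ⟨(Algebra.adjoin g.range (Set.range f)).restrictScalars C, fun _ => Iff.rfl⟩
  have hf : f.range ≤ S := by
    rintro _ ⟨a, rfl⟩
    exact (hS _).2 (Algebra.subset_adjoin ⟨a, rfl⟩)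
  have hg : g.range ≤ S := fun y hy =>
    (hS _).2 ((Algebra.adjoin g.range (Set.range f)).algebraMap_mem ⟨y, hy⟩)
  exact (hS y).1 (sup_le hf hg (h ▸ Algebra.mem_top))

theorem ker_aevalTower {ι : Type*} (g : B →ₐ[C] R) {y : ι → R}
    (hy : AlgebraicIndependent g.range y) :
    RingHom.ker (MvPolynomial.aevalTower g y) = (RingHom.ker g).map MvPolynomial.C := by
  ext p
  have h1 : MvPolynomial.aevalTower g y p =
      MvPolynomial.aeval y (MvPolynomial.map (g.rangeRestrict : B →+* g.range) p) := by
    rw [MvPolynomial.aeval_def, MvPolynomial.eval₂_map]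
    rfl
  have h2 : MvPolynomial.aeval (R := g.range) y
      (MvPolynomial.map (g.rangeRestrict : B →+* g.range) p) = 0 ↔
      MvPolynomial.map (g.rangeRestrict : B →+* g.range) p = 0 :=
    map_eq_zero_iff (MvPolynomial.aeval (R := g.range) y) hy
  rw [RingHom.mem_ker, h1, MvPolynomial.mem_map_C_iff, h2, MvPolynomial.ext_iff]
  simp [MvPolynomial.coeff_map, ← Subtype.val_inj]


theorem trdeg_range {k A R : Type u} [Field k] [CommRing A] [CommRing R] [Algebra k A]
    [Algebra k R] (f : A →ₐ[k] R) :
    Algebra.trdeg k f.range = Algebra.trdeg k (A ⧸ RingHom.ker f) :=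
  (Ideal.quotientKerEquivRange f).trdeg_eq.symm

theorem exists_algebraicIndependent_range {k A B R : Type u} [Field k] [CommRing A] [CommRing B]
    [CommRing R] [IsDomain R] [Algebra k A] [Algebra k B] [Algebra k R] [FinTr k A]
    (f : A →ₐ[k] R) (g : B →ₐ[k] R) (h : f.range ⊔ g.range = ⊤) :
    ∃ (m : ℕ) (x : Fin m → A), AlgebraicIndependent g.range (f ∘ x) ∧
      Algebra.trdeg k (B ⧸ RingHom.ker g) + m = Algebra.trdeg k R := by
  obtain ⟨s, x, hx⟩ := exists_isTranscendenceBasis_range f g h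
  have hfk : (RingHom.ker f).IsPrime := RingHom.ker_isPrime f
  have hxk : AlgebraicIndependent k (f ∘ x) :=
    hx.1.restrictScalars (algebraMap k g.range).injective
  have hxr : AlgebraicIndependent k (f.rangeRestrict ∘ x) :=
    AlgebraicIndependent.of_comp f.range.val hxk
  have hs : #s < ℵ₀ := by
    refine hxr.cardinalMk_le_trdeg.trans_lt ?_
    rw [trdeg_range]
    exact trdeg_quotient_lt _
  have := (Cardinal.lt_aleph0_iff_finite).1 hs
  obtain ⟨m, ⟨e⟩⟩ := Finite.exists_equiv_fin s
  refine ⟨m, x ∘ e.symm, hx.1.comp e.symm e.symm.injective, ?_⟩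
  have : FaithfulSMul g.range R :=
    (faithfulSMul_iff_algebraMap_injective _ _).2 Subtype.val_injective
  rw [← trdeg_range, ← trdeg_add_eq k g.range (A := R), ← hx.cardinalMk_eq_trdeg,
    Cardinal.mk_eq_nat_iff.2 ⟨e⟩]

end basis

section tensor

variable {k A B : Type u} [Field k] [CommRing A] [CommRing B] [Algebra k A] [Algebra k B]

/-- The algebra map `B[X₁, …, Xₘ] → A ⊗ B` sending `Xᵢ` to `xᵢ ⊗ 1`. -/
def polyToTensor {ι : Type*} (x : ι → A) : MvPolynomial ι B →ₐ[k] A ⊗[k] B :=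
  MvPolynomial.aevalTower Algebra.TensorProduct.includeRight (fun i => x i ⊗ₜ 1)

/-- The contraction to the left factor. -/
abbrev leftC (P : Ideal (A ⊗[k] B)) : Ideal A :=
  P.comap (Algebra.TensorProduct.includeLeft : A →ₐ[k] A ⊗[k] B)

/-- The contraction to the right factor. -/
abbrev rightC (P : Ideal (A ⊗[k] B)) : Ideal B :=
  P.comap (Algebra.TensorProduct.includeRight : B →ₐ[k] A ⊗[k] B)

theorem tensor_range_sup {R : Type*} [CommRing R] [Algebra k R] {φ : A ⊗[k] B →ₐ[k] R}
    (hφ : Function.Surjective φ) :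
    (φ.comp (Algebra.TensorProduct.includeLeft : A →ₐ[k] A ⊗[k] B)).range ⊔
      (φ.comp (Algebra.TensorProduct.includeRight : B →ₐ[k] A ⊗[k] B)).range = ⊤ := by
  refine top_le_iff.1 fun y _ => ?_
  obtain ⟨z, rfl⟩ := hφ y
  induction z with
  | zero => rw [map_zero]; exact zero_mem _
  | add a b ha hb => rw [map_add]; exact add_mem (ha trivial) (hb trivial)
  | tmul a b =>
    have : a ⊗ₜ[k] b = (a ⊗ₜ 1) * (1 ⊗ₜ b) := by simp
    rw [this, map_mul]
    exact mul_mem (Algebra.mem_sup_left ⟨a, rfl⟩) (Algebra.mem_sup_right ⟨b, rfl⟩)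

theorem exists_algebraicIndependent_of_isPrime [FinTr k A] (P : Ideal (A ⊗[k] B))
    [P.IsPrime] :
    ∃ (m : ℕ) (x : Fin m → A), AlgebraicIndependent k (Ideal.Quotient.mkₐ k (leftC P) ∘ x) ∧
      Algebra.trdeg k (B ⧸ rightC P) + m = Algebra.trdeg k ((A ⊗[k] B) ⧸ P) ∧
      P.comap (polyToTensor (k := k) (B := B) x) = (rightC P).map MvPolynomial.C := by
  set φ := Ideal.Quotient.mkₐ k P
  set f := φ.comp (Algebra.TensorProduct.includeLeft : A →ₐ[k] A ⊗[k] B) with hf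
  set g := φ.comp (Algebra.TensorProduct.includeRight : B →ₐ[k] A ⊗[k] B) with hg
  have hkf : RingHom.ker f = leftC P := by
    ext a; exact Ideal.Quotient.eq_zero_iff_mem
  have hkg : RingHom.ker g = rightC P := by
    ext a; exact Ideal.Quotient.eq_zero_iff_mem
  obtain ⟨m, x, hx, htr⟩ := exists_algebraicIndependent_range f g
    (tensor_range_sup (Ideal.Quotient.mkₐ_surjective k P))
  rw [hkg] at htr
  refine ⟨m, x, ?_, htr, ?_⟩
  · have hxk : AlgebraicIndependent k (f ∘ x) :=
      hx.restrictScalars (algebraMap k g.range).injective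
    let h : A ⧸ leftC P →ₐ[k] (A ⊗[k] B) ⧸ P := Ideal.quotientMapₐ P _ le_rfl
    exact AlgebraicIndependent.of_comp h hxk
  · rw [← hkg, ← ker_aevalTower g hx]
    have : MvPolynomial.aevalTower g (f ∘ x) = φ.comp (polyToTensor x) := by
      ext <;> simp [polyToTensor, hf, hg]
    rw [this]
    ext a
    exact (Ideal.Quotient.eq_zero_iff_mem (I := P)).symm

instance [FinTr k A] [FinTr k B] : FinTr k (A ⊗[k] B) where
  lt_aleph0 P hP := by
    obtain ⟨m, x, -, h, -⟩ := exists_algebraicIndependent_of_isPrime P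
    rw [← h]
    exact Cardinal.add_lt_aleph0 (trdeg_quotient_lt _) Cardinal.natCast_lt_aleph0

theorem exists_algebraicIndependent_trd [FinTr k A] [FinTr k B] (P : Ideal (A ⊗[k] B))
    [P.IsPrime] :
    ∃ (m : ℕ) (x : Fin m → A), AlgebraicIndependent k (Ideal.Quotient.mkₐ k (leftC P) ∘ x) ∧
      trd k (rightC P) + m = trd k P ∧ m ≤ trd k (leftC P) ∧
      P.comap (polyToTensor (k := k) (B := B) x) = (rightC P).map MvPolynomial.C := by
  obtain ⟨m, x, h1, h2, h3⟩ := exists_algebraicIndependent_of_isPrime P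
  refine ⟨m, x, h1, ?_, ?_, h3⟩
  · rw [← cast_trd, ← cast_trd] at h2
    exact_mod_cast h2
  · have := h1.lift_cardinalMk_le_trdeg
    rw [Cardinal.mk_fin, ← cast_trd] at this
    simpa using this

theorem trd_le_add [FinTr k A] [FinTr k B] (P : Ideal (A ⊗[k] B)) [P.IsPrime] :
    trd k P ≤ trd k (leftC P) + trd k (rightC P) := by
  obtain ⟨m, x, h1, h2, h3, h4⟩ := exists_algebraicIndependent_trd P
  omega

end tensor

section poly

variable {R : Type*} [CommRing R] {I J : Ideal R} {n : ℕ}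

theorem MvPolynomial.comap_C_map_C {σ : Type*} (J : Ideal R) :
    (J.map (MvPolynomial.C (σ := σ))).comap MvPolynomial.C = J := by
  ext r
  rw [Ideal.mem_comap, MvPolynomial.mem_map_C_iff]
  refine ⟨fun h => by simpa using h 0, fun h m => ?_⟩
  classical
  rw [MvPolynomial.coeff_C]
  split_ifs
  · exact h
  · exact zero_mem _

theorem Polynomial.comap_C_map_C (J : Ideal R) :
    (J.map (Polynomial.C)).comap Polynomial.C = J := by
  ext r
  rw [Ideal.mem_comap, Ideal.mem_map_C_iff]
  refine ⟨fun h => by simpa using h 0, fun h m => ?_⟩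
  rw [Polynomial.coeff_C]
  split_ifs
  · exact h
  · exact zero_mem _

theorem MvPolynomial.isPrime_map_C (σ : Type*) (J : Ideal R) [J.IsPrime] :
    (J.map (MvPolynomial.C (σ := σ))).IsPrime := by
  have h : RingHom.ker (MvPolynomial.map (σ := σ) (Ideal.Quotient.mk J)) =
      J.map (MvPolynomial.C (σ := σ)) := by
    rw [MvPolynomial.ker_map, Ideal.mk_ker]
  rw [← h]
  exact RingHom.ker_isPrime _

theorem Ideal.lt_of_map_comap {S : Type*} [CommRing S] {f : R →+* S}
    (hf : ∀ J : Ideal R, (J.map f).comap f = J) {J J' : Ideal R} (h : J < J') :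
    J.map f < J'.map f := by
  refine lt_of_le_of_ne (Ideal.map_mono h.le) fun h' => h.ne ?_
  rw [← hf J, h', hf]

theorem PrimeChain.map_mvPolynomial (σ : Type*) (h : PrimeChain I n J) :
    PrimeChain (I.map (MvPolynomial.C (σ := σ))) n (J.map (MvPolynomial.C (σ := σ))) :=
  h.of_strictMono (f := fun J => J.map (MvPolynomial.C (σ := σ)))
    (fun J _ => MvPolynomial.isPrime_map_C σ J)
    (fun _ _ _ _ hlt => Ideal.lt_of_map_comap MvPolynomial.comap_C_map_C hlt)
    (fun _ _ hle => Ideal.map_mono hle)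

theorem PrimeChain.map_polynomial (h : PrimeChain I n J) :
    PrimeChain (I.map Polynomial.C) n (J.map Polynomial.C) :=
  h.of_strictMono (f := fun J => J.map Polynomial.C)
    (fun J _ => Ideal.isPrime_map_C_iff_isPrime J |>.2 ‹_›)
    (fun _ _ _ _ hlt => Ideal.lt_of_map_comap Polynomial.comap_C_map_C hlt)
    (fun _ _ hle => Ideal.map_mono hle)

theorem PrimeChain.map_C_mono {m t : ℕ} (hmt : m ≤ t)
    (h : PrimeChain (I.map (MvPolynomial.C (σ := Fin m))) n (J.map (MvPolynomial.C (σ := Fin m)))) :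
    PrimeChain (I.map (MvPolynomial.C (σ := Fin t))) n
      (J.map (MvPolynomial.C (σ := Fin t))) := by
  let e : MvPolynomial (Fin t) R ≃ₐ[R] MvPolynomial (Fin (t - m)) (MvPolynomial (Fin m) R) :=
    (MvPolynomial.renameEquiv R ((finCongr (by omega)).trans finSumFinEquiv.symm)).trans
      (MvPolynomial.sumAlgEquiv R (Fin (t - m)) (Fin m))
  have key : ∀ L : Ideal R, ((L.map (MvPolynomial.C (σ := Fin m))).map
      (MvPolynomial.C (σ := Fin (t - m)))).comap (e : _ →+* _) =
      L.map (MvPolynomial.C (σ := Fin t)) := by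
    intro L
    have h1 : L.map (MvPolynomial.C (σ := Fin m)) = L.map (algebraMap R _) := rfl
    have h2 : (L.map (MvPolynomial.C (σ := Fin m))).map (MvPolynomial.C (σ := Fin (t - m))) =
        (L.map (MvPolynomial.C (σ := Fin t))).map (e : _ →+* _) := by
      rw [Ideal.map_map, Ideal.map_map]
      congr 1
      exact RingHom.ext fun r => (e.commutes r).symm
    rw [h2]
    exact Ideal.comap_map_of_bijective _ e.bijective
  have h1 := (h.map_mvPolynomial (Fin (t - m))).comap
    (f := (e : MvPolynomial (Fin t) R →+* _)) e.surjective
  rwa [key, key] at h1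

end poly

section trdpoly

variable {k R : Type u} [Field k] [CommRing R] [Algebra k R]

theorem FinTr.of_equiv {R' : Type u} [CommRing R'] [Algebra k R'] [FinTr k R] (e : R ≃ₐ[k] R') :
    FinTr k R' := FinTr.of_surjective e.toAlgHom e.surjective

instance [FinTr k R] : FinTr k (Polynomial R) := by
  have : FinTr k (Polynomial k) := .of_trdeg (by
    rw [Polynomial.trdeg_of_isDomain]; exact Cardinal.one_lt_aleph0)
  exact FinTr.of_equiv (polyEquivTensor k R).symm

instance [FinTr k R] (m : ℕ) : FinTr k (MvPolynomial (Fin m) R) := by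
  induction m with
  | zero => exact FinTr.of_equiv ((MvPolynomial.isEmptyAlgEquiv R (Fin 0)).symm.restrictScalars k)
  | succ m ih => exact FinTr.of_equiv ((MvPolynomial.finSuccEquiv R m).symm.restrictScalars k)

theorem trd_ker {R' : Type u} [CommRing R'] [Algebra k R'] {f : R →ₐ[k] R'}
    (hf : Function.Surjective f) : trd k (RingHom.ker f) = (Algebra.trdeg k R').toNat := by
  rw [trd, (Ideal.quotientKerAlgEquivOfSurjective hf).trdeg_eq]

theorem trd_map_polynomial_C [FinTr k R] (N : Ideal R) [hN : N.IsPrime] :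
    trd k N + 1 ≤ trd k (N.map Polynomial.C) := by
  have hp : (N.map Polynomial.C).IsPrime := (Ideal.isPrime_map_C_iff_isPrime N).2 hN
  have h2 : Algebra.trdeg k (Polynomial (R ⧸ N)) = Algebra.trdeg k (R ⧸ N) + 1 := by
    rw [← Polynomial.trdeg_of_isDomain (R := R ⧸ N)]
    exact (trdeg_add_eq k (R ⧸ N) (A := Polynomial (R ⧸ N))).symm
  have h3 : RingHom.ker (Polynomial.mapAlgHom (Ideal.Quotient.mkₐ k N)) = N.map Polynomial.C := by
    have := Polynomial.ker_mapRingHom (Ideal.Quotient.mk N)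
    rw [Ideal.mk_ker] at this
    exact this
  rw [← h3, trd_ker (Polynomial.map_surjective _ Ideal.Quotient.mk_surjective), h2, ← cast_trd N]
  have : ((trd k N : Cardinal) + 1) = ((trd k N + 1 : ℕ) : Cardinal) := by push_cast; rfl
  rw [this, Cardinal.toNat_natCast]

theorem primeChain_mvPolynomial [FinTr k R] {m : ℕ} (N : Ideal (MvPolynomial (Fin m) R))
    [hN : N.IsPrime] :
    PrimeChain ((N.comap (MvPolynomial.C)).map MvPolynomial.C)
      (m + trd k (N.comap (MvPolynomial.C)) - trd k N) N := by
  induction m with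
  | zero =>
    have h : 0 + trd k (N.comap MvPolynomial.C) - trd k N = 0 := by
      rw [zero_add, Nat.sub_eq_zero_iff_le]
      exact trd_comap_le (IsScalarTower.toAlgHom k R (MvPolynomial (Fin 0) R)) N
    rw [h]
    exact ⟨hN, Ideal.map_comap_le⟩
  | succ m ih =>
    obtain ⟨e, hb, he⟩ : ∃ e : MvPolynomial (Fin (m + 1)) R →ₐ[k]
        Polynomial (MvPolynomial (Fin m) R), Function.Bijective e ∧
        e.toRingHom.comp MvPolynomial.C = Polynomial.C.comp MvPolynomial.C :=
      ⟨(MvPolynomial.finSuccEquiv R m).toAlgHom.restrictScalars k,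
        (MvPolynomial.finSuccEquiv R m).bijective,
        RingHom.ext fun r => (MvPolynomial.finSuccEquiv R m).commutes r⟩
    obtain ⟨N', hpN', rfl⟩ : ∃ N' : Ideal (Polynomial (MvPolynomial (Fin m) R)),
        N'.IsPrime ∧ N'.comap e.toRingHom = N :=
      ⟨N.map e.toRingHom, Ideal.map_isPrime_of_equiv (RingEquiv.ofBijective e hb),
        Ideal.comap_map_of_bijective _ hb⟩
    have ht : trd k (N'.comap e.toRingHom) = trd k N' :=
      trd_comap_of_surjective (f := e) hb.2 N'
    have hpN0 : (N'.comap Polynomial.C).IsPrime := hpN'.comap _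
    have h1 := (ih (N'.comap Polynomial.C)).map_polynomial
    rw [Ideal.comap_comap, he, ht]
    rw [Ideal.comap_comap] at h1
    have hle : (N'.comap Polynomial.C).map Polynomial.C ≤ N' := Ideal.map_comap_le
    set q := N'.comap (Polynomial.C.comp MvPolynomial.C) with hq
    have h2 : PrimeChain ((q.map MvPolynomial.C).map Polynomial.C)
        (m + 1 + trd k q - trd k N') N' := by
      rcases hle.eq_or_lt with heq | hlt
      · have := trd_map_polynomial_C (k := k) (N'.comap Polynomial.C)
        rw [heq] at this h1
        exact h1.of_le (by omega)
      · have : trd k (N'.comap Polynomial.C) ≤ trd k N' :=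
          trd_comap_le (Polynomial.CAlgHom (R := k) (A := MvPolynomial (Fin m) R)) N'
        exact (h1.succ_of_lt hpN' hlt).of_le (by omega)
    refine (h2.comap (f := e.toRingHom) hb.2).mono_left ?_
    rw [Ideal.map_le_iff_le_comap, Ideal.comap_comap, he, ← Ideal.comap_comap,
      ← Ideal.map_le_iff_le_comap, ← Ideal.map_le_iff_le_comap]

end trdpoly

theorem Module.Flat.of_injective_field (C L : Type*) [CommRing C] [IsDomain C] [Field L]
    [Algebra C L] (h : Function.Injective (algebraMap C L)) : Module.Flat C L := by
  have : FaithfulSMul C L := (faithfulSMul_iff_algebraMap_injective C L).2 h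
  let : Algebra (FractionRing C) L := FractionRing.liftAlgebra C L
  have : IsScalarTower C (FractionRing C) L := FractionRing.isScalarTower_liftAlgebra C L
  have : Module.Flat C (FractionRing C) := IsLocalization.flat _ (nonZeroDivisors C)
  exact Module.Flat.trans C (FractionRing C) L

theorem PrimeChain.of_flat_roof {Q S Y : Type*} [CommRing Q] [CommRing S] [CommRing Y]
    [Algebra Q Y] [Module.Flat Q Y] {Φ : Q →+* S} {Ψ : S →+* Y}
    (hΨ : Ψ.comp Φ = algebraMap Q Y)
    (hlt : ∀ J J' : Ideal Y, J.IsPrime → J'.IsPrime → J < J' → J.comap Ψ < J'.comap Ψ)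
    {P : Ideal Y} [hP : P.IsPrime] {I : Ideal Q} {n : ℕ}
    (h : PrimeChain I n ((P.comap Ψ).comap Φ)) : PrimeChain (I.map Φ) n (P.comap Ψ) := by
  rw [Ideal.comap_comap, hΨ] at h
  refine (h.lift hP).of_strictMono (f := fun J => J.comap Ψ) (fun J hJ => hJ.comap Ψ) hlt ?_
  intro J _ hJ
  rw [Ideal.map_le_iff_le_comap, Ideal.comap_comap, hΨ]
  exact Ideal.map_le_iff_le_comap.1 hJ

section roof

variable {k A B C Q L : Type u} [Field k] [CommRing A] [CommRing B] [CommRing C]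
  [CommRing Q] [Field L] [Algebra k A] [Algebra k B] [Algebra k C] [Algebra k Q] [Algebra k L]
  [Algebra C Q] [IsScalarTower k C Q] [Algebra C A] [Algebra A L]
  [Algebra C L] [IsScalarTower C A L] [IsScalarTower k A L] [IsScalarTower k C L]

variable (A C L) in
/-- The canonical map from `A ⊗ B` to the base change of `Q` to the fraction field of `A`. -/
def tensorToBaseChange (β : B →ₐ[k] Q) : A ⊗[k] B →ₐ[k] Q ⊗[C] L :=
  Algebra.TensorProduct.lift
    (((Algebra.TensorProduct.includeRight : L →ₐ[C] Q ⊗[C] L).restrictScalars k).comp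
      (IsScalarTower.toAlgHom k A L))
    ((Algebra.TensorProduct.includeLeft : Q →ₐ[k] Q ⊗[C] L).comp β)
    (fun _ _ => Commute.all _ _)

omit [Algebra C A] [IsScalarTower C A L] in
@[simp]
theorem tensorToBaseChange_tmul (β : B →ₐ[k] Q) (a : A) (b : B) :
    tensorToBaseChange A C L β (a ⊗ₜ b) = β b ⊗ₜ algebraMap A L a := by
  simp [tensorToBaseChange]


theorem exists_lift_tensorToBaseChange {F : Type*} [CommRing F] [Algebra k F] (β : B →ₐ[k] Q)
    (Φ : Q →ₐ[k] A ⊗[k] B) (hΦβ : ∀ b, Φ (β b) = 1 ⊗ₜ b)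
    (hΦC : ∀ c, Φ (algebraMap C Q c) = algebraMap C A c ⊗ₜ 1) (π : A ⊗[k] B →ₐ[k] F)
    (αL : L →+* F) (hαL : ∀ a : A, αL (algebraMap A L a) = π (a ⊗ₜ 1)) :
    ∃ θ : Q ⊗[C] L →+* F, ∀ z, θ (tensorToBaseChange A C L β z) = π z := by
  let : Algebra C F := (αL.comp (algebraMap C L)).toAlgebra
  let θL : L →ₐ[C] F := { αL with commutes' := fun c => rfl }
  let θQ : Q →ₐ[C] F := { (π.comp Φ).toRingHom with
    commutes' := fun c => by
      refine (congrArg π (hΦC c)).trans ((hαL _).symm.trans ?_)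
      rw [← IsScalarTower.algebraMap_apply C A L]
      rfl }
  let θ : Q ⊗[C] L →ₐ[C] F := Algebra.TensorProduct.lift θQ θL (fun _ _ => Commute.all _ _)
  refine ⟨θ.toRingHom, fun z => ?_⟩
  change θ _ = _
  induction z with
  | zero => simp
  | add _ _ h1 h2 => rw [map_add, map_add, h1, h2, map_add]
  | tmul a b =>
    have h2 : θ (tensorToBaseChange A C L β (a ⊗ₜ b)) = π (Φ (β b)) * αL (algebraMap A L a) := by
      rw [tensorToBaseChange_tmul]
      exact Algebra.TensorProduct.lift_tmul θQ θL _ _ _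
    rw [h2, hΦβ, hαL, ← map_mul]
    simp

theorem PrimeChain.of_baseChange [IsDomain A] [IsFractionRing A L] [IsDomain C]
    (hCA : Function.Injective (algebraMap C A)) (β : B →ₐ[k] Q) (Φ : Q →ₐ[k] A ⊗[k] B)
    (hΦβ : ∀ b, Φ (β b) = 1 ⊗ₜ b) (hΦC : ∀ c, Φ (algebraMap C Q c) = algebraMap C A c ⊗ₜ 1)
    (hgen : Subring.closure (Set.range β ∪ Set.range (algebraMap C Q)) = ⊤)
    (P : Ideal (A ⊗[k] B)) [hP : P.IsPrime] (hPA : leftC P = ⊥) {I : Ideal Q} {n : ℕ}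
    (h : PrimeChain I n (P.comap Φ)) : PrimeChain (I.map Φ) n P := by
  have hCL : Function.Injective (algebraMap C L) := by
    rw [IsScalarTower.algebraMap_eq C A L]
    exact (IsFractionRing.injective A L).comp hCA
  have : Module.Flat C L := .of_injective_field C L hCL
  let Ψ := tensorToBaseChange A C L β
  have hΨ : Ψ.toRingHom.comp Φ.toRingHom = algebraMap Q (Q ⊗[C] L) := by
    refine RingHom.eq_of_eqOn_set_dense hgen ?_
    rintro _ (⟨b, rfl⟩ | ⟨c, rfl⟩)
    · simp [hΦβ, Ψ]
    · simp only [AlgHom.toRingHom_eq_coe, RingHom.coe_comp, RingHom.coe_coe, Function.comp_apply,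
        hΦC, Ψ, tensorToBaseChange_tmul, map_one, Algebra.TensorProduct.algebraMap_apply,
        Algebra.algebraMap_self, RingHom.id_apply]
      rw [← IsScalarTower.algebraMap_apply C A L, Algebra.algebraMap_eq_smul_one,
        ← TensorProduct.smul_tmul, ← Algebra.algebraMap_eq_smul_one]
  have hden : ∀ y : Q ⊗[C] L, ∃ a : A, a ≠ 0 ∧ ∃ z, Ψ z = (1 ⊗ₜ algebraMap A L a) * y := by
    intro y
    induction y with
    | zero => exact ⟨1, one_ne_zero, 0, by simp⟩
    | add y₁ y₂ h₁ h₂ =>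
      obtain ⟨a₁, ha₁, z₁, hz₁⟩ := h₁
      obtain ⟨a₂, ha₂, z₂, hz₂⟩ := h₂
      refine ⟨a₁ * a₂, mul_ne_zero ha₁ ha₂, (a₂ ⊗ₜ 1) * z₁ + (a₁ ⊗ₜ 1) * z₂, ?_⟩
      have h1 : ∀ a : A, Ψ (a ⊗ₜ 1) = 1 ⊗ₜ algebraMap A L a := fun a => by simp [Ψ]
      have h2 : (1 : Q) ⊗ₜ[C] algebraMap A L (a₁ * a₂) =
          (1 ⊗ₜ algebraMap A L a₁) * (1 ⊗ₜ algebraMap A L a₂) := by simp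
      rw [map_add, map_mul, map_mul, h1, h1, hz₁, hz₂, h2]
      ring
    | tmul p l =>
      obtain ⟨a, b, hb, rfl⟩ := IsFractionRing.div_surjective (A := A) l
      have hb0 : b ≠ 0 := nonZeroDivisors.ne_zero hb
      refine ⟨b, hb0, (a ⊗ₜ 1) * Φ p, ?_⟩
      have h1 : Ψ (Φ p) = p ⊗ₜ 1 := RingHom.congr_fun hΨ p
      have hb1 : algebraMap A L b ≠ 0 := (map_ne_zero_iff _ (IsFractionRing.injective A L)).2 hb0
      rw [map_mul, h1, tensorToBaseChange_tmul, Algebra.TensorProduct.tmul_mul_tmul,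
        Algebra.TensorProduct.tmul_mul_tmul, mul_div_cancel₀ _ hb1]
      simp
  have hunit : ∀ a : A, a ≠ 0 → IsUnit ((1 : Q) ⊗ₜ[C] algebraMap A L a) := by
    intro a ha
    have hb1 : algebraMap A L a ≠ 0 := (map_ne_zero_iff _ (IsFractionRing.injective A L)).2 ha
    exact (IsUnit.mk0 _ hb1).map (Algebra.TensorProduct.includeRight : L →ₐ[C] Q ⊗[C] L)
  have hlt : ∀ J J' : Ideal (Q ⊗[C] L), J.IsPrime → J'.IsPrime → J < J' →
      J.comap Ψ.toRingHom < J'.comap Ψ.toRingHom := by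
    intro J J' hJ hJ' hlt
    obtain ⟨y, hy', hy⟩ := SetLike.exists_of_lt hlt
    obtain ⟨a, ha, z, hz⟩ := hden y
    refine SetLike.lt_iff_le_and_exists.2 ⟨Ideal.comap_mono hlt.le, z, ?_, ?_⟩
    · exact Ideal.mem_comap.2 (hz ▸ Ideal.mul_mem_left _ _ hy')
    · intro hzJ
      have hzJ' : Ψ z ∈ J := hzJ
      rw [hz] at hzJ'
      rcases hJ.mem_or_mem hzJ' with h1 | h1
      · exact hJ.ne_top (Ideal.eq_top_of_isUnit_mem _ h1 (hunit a ha))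
      · exact hy h1
  obtain ⟨P', hP', hPP⟩ : ∃ P' : Ideal (Q ⊗[C] L), P'.IsPrime ∧ P'.comap Ψ.toRingHom = P := by
    let R := (A ⊗[k] B) ⧸ P
    let F := FractionRing R
    let π : A ⊗[k] B →ₐ[k] F :=
      (IsScalarTower.toAlgHom k R F).comp (Ideal.Quotient.mkₐ k P)
    have hkπ : ∀ z, π z = 0 ↔ z ∈ P := fun z =>
      (map_eq_zero_iff _ (IsFractionRing.injective R F)).trans Ideal.Quotient.eq_zero_iff_mem
    let αA : A →+* F := (π.comp Algebra.TensorProduct.includeLeft).toRingHom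
    have hαA : Function.Injective αA := by
      rw [injective_iff_map_eq_zero]
      intro a ha
      have : a ∈ leftC P := (hkπ _).1 ha
      rwa [hPA] at this
    let αL : L →+* F := IsFractionRing.lift hαA
    have hαL : ∀ a, αL (algebraMap A L a) = αA a := IsFractionRing.lift_algebraMap hαA
    obtain ⟨θ, hθ⟩ := exists_lift_tensorToBaseChange β Φ hΦβ hΦC π αL hαL
    refine ⟨RingHom.ker θ, RingHom.ker_isPrime _, ?_⟩
    ext z
    exact (congrArg (· = 0) (hθ z)).to_iff.trans (hkπ z)
  have key := PrimeChain.of_flat_roof hΨ hlt (P := P') (I := I) (n := n)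
  rw [hPP] at key
  exact key h

end roof

section fibers

variable {k A B : Type u} [Field k] [CommRing A] [CommRing B] [Algebra k A] [Algebra k B]

theorem PrimeChain.of_polyToTensor_aux (L : Type u) [Field L] [Algebra A L] [IsFractionRing A L]
    [Algebra k L] [IsScalarTower k A L] [IsDomain A] {m : ℕ} {x : Fin m → A}
    (hx : AlgebraicIndependent k x) (P : Ideal (A ⊗[k] B)) [hP : P.IsPrime] (hPA : leftC P = ⊥)
    {I : Ideal (MvPolynomial (Fin m) B)} {n : ℕ}
    (h : PrimeChain I n (P.comap (polyToTensor x))) :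
    PrimeChain (I.map (polyToTensor x)) n P := by
  let C := MvPolynomial (Fin m) k
  let : Algebra C (MvPolynomial (Fin m) B) := MvPolynomial.algebraMvPolynomial
  have : IsScalarTower k C (MvPolynomial (Fin m) B) := .of_algebraMap_eq fun c => by
    change _ = MvPolynomial.map _ (MvPolynomial.C c)
    rw [MvPolynomial.map_C]
    rfl
  let : Algebra C A := (MvPolynomial.aeval x).toAlgebra
  have : IsScalarTower k C A := .of_algebraMap_eq fun c =>
    ((MvPolynomial.aeval x).commutes c).symm
  let : Algebra C L := ((algebraMap A L).comp (algebraMap C A)).toAlgebra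
  have : IsScalarTower C A L := .of_algebraMap_eq fun _ => rfl
  have : IsScalarTower k C L := .of_algebraMap_eq fun c => by
    rw [IsScalarTower.algebraMap_apply C A L, ← IsScalarTower.algebraMap_apply k C A,
      ← IsScalarTower.algebraMap_apply k A L]
  refine PrimeChain.of_baseChange (C := C) (L := L) hx
    (IsScalarTower.toAlgHom k B (MvPolynomial (Fin m) B)) (polyToTensor x) ?_ ?_ ?_ P hPA h
  · intro b
    simp [polyToTensor]
  · intro c
    change polyToTensor x (MvPolynomial.map _ c) = MvPolynomial.aeval x c ⊗ₜ 1
    induction c using MvPolynomial.induction_on with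
    | C a => simp [polyToTensor, Algebra.TensorProduct.algebraMap_apply]
    | add p q hp hq => rw [map_add, map_add, hp, hq, map_add, TensorProduct.add_tmul]
    | mul_X p i hp =>
      rw [map_mul, map_mul, hp, map_mul]
      simp [polyToTensor]
  · refine top_unique fun p _ => ?_
    induction p using MvPolynomial.induction_on with
    | C a => exact Subring.subset_closure (Or.inl ⟨a, rfl⟩)
    | add p q hp hq => exact add_mem (hp trivial) (hq trivial)
    | mul_X p i hp =>
      refine mul_mem (hp trivial) (Subring.subset_closure (Or.inr ⟨MvPolynomial.X i, ?_⟩))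
      exact MvPolynomial.map_X _ _

theorem PrimeChain.of_polyToTensor [IsDomain A] {m : ℕ} {x : Fin m → A}
    (hx : AlgebraicIndependent k x) (P : Ideal (A ⊗[k] B)) [P.IsPrime] (hPA : leftC P = ⊥)
    {I : Ideal (MvPolynomial (Fin m) B)} {n : ℕ}
    (h : PrimeChain I n (P.comap (polyToTensor x))) :
    PrimeChain (I.map (polyToTensor x)) n P :=
  of_polyToTensor_aux (FractionRing A) hx P hPA h

end fibers

section quotientTensor

variable {k A B A' B' : Type u} [Field k] [CommRing A] [CommRing B] [Algebra k A] [Algebra k B]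
  [CommRing A'] [CommRing B'] [Algebra k A'] [Algebra k B']

theorem leftC_comap_map (f : A →ₐ[k] A') (g : B →ₐ[k] B') (P : Ideal (A' ⊗[k] B')) :
    leftC (P.comap (Algebra.TensorProduct.map f g)) = (leftC P).comap f := by
  ext a
  simp [leftC, Ideal.mem_comap]

theorem rightC_comap_map (f : A →ₐ[k] A') (g : B →ₐ[k] B') (P : Ideal (A' ⊗[k] B')) :
    rightC (P.comap (Algebra.TensorProduct.map f g)) = (rightC P).comap g := by
  ext a
  simp [rightC, Ideal.mem_comap]

theorem ker_tensorMap {f : A →ₐ[k] A'} {g : B →ₐ[k] B'} (hf : Function.Surjective f)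
    (hg : Function.Surjective g) : RingHom.ker (Algebra.TensorProduct.map f g).toRingHom =
      (RingHom.ker f).map (Algebra.TensorProduct.includeLeft : A →ₐ[k] A ⊗[k] B) ⊔
      (RingHom.ker g).map (Algebra.TensorProduct.includeRight : B →ₐ[k] A ⊗[k] B) :=
  Algebra.TensorProduct.map_ker f g hf hg

theorem tensorMap_surjective {f : A →ₐ[k] A'} {g : B →ₐ[k] B'} (hf : Function.Surjective f)
    (hg : Function.Surjective g) :
    Function.Surjective (Algebra.TensorProduct.map f g).toRingHom :=
  TensorProduct.map_surjective (g := f.toLinearMap) (g' := g.toLinearMap) hf hg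

theorem exists_comap_tensorMap {f : A →ₐ[k] A'} {g : B →ₐ[k] B'} (hf : Function.Surjective f)
    (hg : Function.Surjective g) {P : Ideal (A ⊗[k] B)} (hP : P.IsPrime)
    (h1 : RingHom.ker f ≤ leftC P) (h2 : RingHom.ker g ≤ rightC P) :
    ∃ P' : Ideal (A' ⊗[k] B'), P'.IsPrime ∧
      P'.comap (Algebra.TensorProduct.map f g).toRingHom = P := by
  have hF := tensorMap_surjective hf hg
  have hk : RingHom.ker (Algebra.TensorProduct.map f g).toRingHom ≤ P := by
    rw [ker_tensorMap hf hg]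
    exact sup_le (Ideal.map_le_iff_le_comap.2 h1) (Ideal.map_le_iff_le_comap.2 h2)
  refine ⟨P.map (Algebra.TensorProduct.map f g).toRingHom,
    Ideal.map_isPrime_of_surjective hF hk, ?_⟩
  rw [Ideal.comap_map_of_surjective _ hF]
  exact sup_eq_left.2 hk

theorem ker_mkₐ (I : Ideal A) : RingHom.ker (Ideal.Quotient.mkₐ k I) = I :=
  Ideal.mk_ker

theorem ker_algHom_id : RingHom.ker (AlgHom.id k A) = ⊥ :=
  (RingHom.injective_iff_ker_eq_bot (RingHom.id A)).1 fun _ _ h => h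

end quotientTensor

section goingDown

variable {k A B : Type u} [Field k] [CommRing A] [CommRing B] [Algebra k A] [Algebra k B]

/-- Chains in the left factor lift modulo an ideal of the right factor. -/
theorem PrimeChain.lift_leftC {q : Ideal B} {W : Ideal (A ⊗[k] B)} (hW : W.IsPrime)
    (hq : q ≤ rightC W) {I : Ideal A} {n : ℕ} (h : PrimeChain I n (leftC W)) :
    PrimeChain (I.map (Algebra.TensorProduct.includeLeft : A →ₐ[k] A ⊗[k] B) ⊔
      q.map (Algebra.TensorProduct.includeRight : B →ₐ[k] A ⊗[k] B)) n W := by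
  have hf : Function.Surjective (AlgHom.id k A) := Function.surjective_id
  have hg := Ideal.Quotient.mkₐ_surjective k q
  obtain ⟨W', hW', rfl⟩ := exists_comap_tensorMap hf hg hW
    (by rw [ker_algHom_id]; exact bot_le) (by rwa [ker_mkₐ])
  have h' : PrimeChain I n (W'.comap (algebraMap A (A ⊗[k] (B ⧸ q)))) := by
    have := leftC_comap_map (AlgHom.id k A) (Ideal.Quotient.mkₐ k q) W'
    have h2 : leftC W' = W'.comap (algebraMap A (A ⊗[k] (B ⧸ q))) := rfl
    rw [← h2]
    exact this ▸ h
  refine ((h'.lift hW').comap (tensorMap_surjective hf hg)).mono_left (sup_le ?_ ?_)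
  · rw [Ideal.map_le_iff_le_comap]
    intro a ha
    have : (algebraMap A (A ⊗[k] (B ⧸ q)) a) ∈ I.map (algebraMap A (A ⊗[k] (B ⧸ q))) :=
      Ideal.mem_map_of_mem _ ha
    simpa [Ideal.mem_comap] using this
  · refine le_trans ?_ (Ideal.comap_mono bot_le)
    have := ker_tensorMap hf hg
    rw [ker_mkₐ] at this
    exact le_trans le_sup_right this.ge

theorem exists_le_leftC_eq {p : Ideal A} [p.IsPrime] {q : Ideal B} {W : Ideal (A ⊗[k] B)}
    (hW : W.IsPrime) (hp : p ≤ leftC W) (hq : q ≤ rightC W) :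
    ∃ V : Ideal (A ⊗[k] B), V.IsPrime ∧ V ≤ W ∧ leftC V = p ∧ q ≤ rightC V := by
  have hf : Function.Surjective (AlgHom.id k A) := Function.surjective_id
  have hg := Ideal.Quotient.mkₐ_surjective k q
  obtain ⟨W', hW', rfl⟩ := exists_comap_tensorMap hf hg hW
    (by rw [ker_algHom_id]; exact bot_le) (by rwa [ker_mkₐ])
  have h1 := leftC_comap_map (AlgHom.id k A) (Ideal.Quotient.mkₐ k q) W'
  have : W'.LiesOver (W'.comap (algebraMap A (A ⊗[k] (B ⧸ q)))) := ⟨rfl⟩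
  obtain ⟨V', h2, h3, h4⟩ := W'.exists_ideal_le_liesOver_of_le
    (p := p) (q := W'.comap (algebraMap A (A ⊗[k] (B ⧸ q)))) (h1 ▸ hp)
  refine ⟨V'.comap (Algebra.TensorProduct.map (AlgHom.id k A) (Ideal.Quotient.mkₐ k q)),
    h3.comap _, Ideal.comap_mono h2, ?_, ?_⟩
  · rw [leftC_comap_map]
    exact h4.over.symm
  · rw [rightC_comap_map]
    refine le_trans (ker_mkₐ (k := k) q).ge (Ideal.comap_mono bot_le)

theorem exists_le_rightC_eq {p : Ideal A} {q : Ideal B} [q.IsPrime] {W : Ideal (A ⊗[k] B)}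
    (hW : W.IsPrime) (hp : p ≤ leftC W) (hq : q ≤ rightC W) :
    ∃ V : Ideal (A ⊗[k] B), V.IsPrime ∧ V ≤ W ∧ p ≤ leftC V ∧ rightC V = q := by
  let e := Algebra.TensorProduct.comm k A B
  have e1 : ∀ V : Ideal (A ⊗[k] B), leftC (V.comap e.symm.toAlgHom) = rightC V := fun V => by
    ext; simp [leftC, rightC, e, Ideal.mem_comap]
  have e2 : ∀ V : Ideal (A ⊗[k] B), rightC (V.comap e.symm.toAlgHom) = leftC V := fun V => by
    ext; simp [leftC, rightC, e, Ideal.mem_comap]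
  have e3 : ∀ V : Ideal (B ⊗[k] A), leftC (V.comap e.toAlgHom) = rightC V := fun V => by
    ext; simp [leftC, rightC, e, Ideal.mem_comap]
  have e4 : ∀ V : Ideal (B ⊗[k] A), rightC (V.comap e.toAlgHom) = leftC V := fun V => by
    ext; simp [leftC, rightC, e, Ideal.mem_comap]
  obtain ⟨V, h1, h2, h3, h4⟩ := exists_le_leftC_eq (p := q) (q := p)
    (hW.comap e.symm.toAlgHom) (by rwa [e1]) (by rwa [e2])
  refine ⟨V.comap e.toAlgHom, h1.comap _, ?_, by rwa [e3], by rwa [e4]⟩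
  refine le_trans (Ideal.comap_mono h2) fun z hz => ?_
  have : e.symm (e z) ∈ W := hz
  rwa [e.symm_apply_apply] at this

theorem exists_le_contractions_eq {p : Ideal A} [p.IsPrime] {q : Ideal B} [q.IsPrime]
    {W : Ideal (A ⊗[k] B)} (hW : W.IsPrime) (hp : p ≤ leftC W) (hq : q ≤ rightC W) :
    ∃ V : Ideal (A ⊗[k] B), V.IsPrime ∧ V ≤ W ∧ leftC V = p ∧ rightC V = q := by
  obtain ⟨V, h1, h2, h3, h4⟩ := exists_le_leftC_eq hW hp hq
  obtain ⟨V', h1', h2', h3', h4'⟩ := exists_le_rightC_eq h1 h3.ge h4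
  exact ⟨V', h1', h2'.trans h2, le_antisymm (h3 ▸ Ideal.comap_mono h2') h3', h4'⟩

end goingDown

section estimates

variable {k A B : Type u} [Field k] [CommRing A] [CommRing B] [Algebra k A] [Algebra k B]

theorem exists_algebraicIndependent_fin [FinTr k A] [IsDomain A] :
    ∃ x : Fin (trd k (⊥ : Ideal A)) → A, AlgebraicIndependent k x := by
  obtain ⟨ι, x, hx⟩ := exists_isTranscendenceBasis' k A
  have h1 : Cardinal.mk ι = trd k (⊥ : Ideal A) := by
    rw [trd_bot, Cardinal.cast_toNat_of_lt_aleph0 trdeg_lt]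
    exact hx.cardinalMk_eq_trdeg
  obtain ⟨e⟩ := Cardinal.mk_eq_nat_iff.1 h1
  exact ⟨x ∘ e.symm, hx.1.comp _ e.symm.injective⟩

theorem polyToTensor_comp_C {ι : Type*} (x : ι → A) :
    (polyToTensor (k := k) (B := B) x).toRingHom.comp MvPolynomial.C =
      (Algebra.TensorProduct.includeRight : B →ₐ[k] A ⊗[k] B).toRingHom := by
  ext b
  simp [polyToTensor]

theorem comap_C_comap_polyToTensor {ι : Type*} (x : ι → A) (P : Ideal (A ⊗[k] B)) :
    (P.comap (polyToTensor x)).comap MvPolynomial.C = rightC P := by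
  ext b
  simp [polyToTensor, rightC, Ideal.mem_comap]

variable [FinTr k A] [FinTr k B]

theorem PrimeChain.of_leftC_eq_bot [IsDomain A] {P : Ideal (A ⊗[k] B)} (hP : P.IsPrime)
    (hPA : leftC P = ⊥) :
    PrimeChain ((rightC P).map (Algebra.TensorProduct.includeRight : B →ₐ[k] A ⊗[k] B))
      (trd k (⊥ : Ideal A) + trd k (rightC P) - trd k P) P := by
  obtain ⟨x, hx⟩ := exists_algebraicIndependent_fin (k := k) (A := A)
  have h1 := primeChain_mvPolynomial (k := k) (P.comap (polyToTensor (k := k) (B := B) x))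
  have h2 : trd k (P.comap (polyToTensor (k := k) (B := B) x)) ≤ trd k P := trd_comap_le _ _
  rw [comap_C_comap_polyToTensor] at h1
  have h3 := of_polyToTensor hx P hPA h1
  have h4 : ((rightC P).map MvPolynomial.C).map (polyToTensor (k := k) (B := B) x) =
      (rightC P).map (Algebra.TensorProduct.includeRight : B →ₐ[k] A ⊗[k] B) := by
    have := Ideal.map_map (I := rightC P) MvPolynomial.C
      (polyToTensor (k := k) (B := B) x).toRingHom
    rw [polyToTensor_comp_C] at this
    exact this
  rw [h4] at h3
  exact h3.of_le (by omega)

/-- A prime of `A ⊗ B` has large height over the ideal generated by its contractions. -/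
theorem PrimeChain.of_contractions {P : Ideal (A ⊗[k] B)} (hP : P.IsPrime) :
    PrimeChain ((leftC P).map (Algebra.TensorProduct.includeLeft : A →ₐ[k] A ⊗[k] B) ⊔
      (rightC P).map (Algebra.TensorProduct.includeRight : B →ₐ[k] A ⊗[k] B))
      (trd k (leftC P) + trd k (rightC P) - trd k P) P := by
  have hf := Ideal.Quotient.mkₐ_surjective k (leftC P)
  have hg : Function.Surjective (AlgHom.id k B) := Function.surjective_id
  have hp : (leftC P).IsPrime := hP.comap _
  obtain ⟨P', hP', hPP⟩ := exists_comap_tensorMap hf hg hP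
    (by rw [ker_mkₐ]) (by rw [ker_algHom_id]; exact bot_le)
  have hPP' : P'.comap (Algebra.TensorProduct.map (Ideal.Quotient.mkₐ k (leftC P))
    (AlgHom.id k B)) = P := hPP
  have h1 : leftC P' = ⊥ := by
    have := leftC_comap_map (Ideal.Quotient.mkₐ k (leftC P)) (AlgHom.id k B) P'
    rw [hPP'] at this
    refine (Ideal.comap_injective_of_surjective _ hf) (this.symm.trans ?_)
    exact (ker_mkₐ (k := k) (leftC P)).symm
  have h2 : rightC P' = rightC P := by
    have := rightC_comap_map (Ideal.Quotient.mkₐ k (leftC P)) (AlgHom.id k B) P'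
    rw [hPP'] at this
    exact this.symm
  have h3 : trd k P' = trd k P := by
    have := trd_comap_of_surjective (f := Algebra.TensorProduct.map
      (Ideal.Quotient.mkₐ k (leftC P)) (AlgHom.id k B)) (tensorMap_surjective hf hg) P'
    exact this.symm.trans (congrArg _ hPP')
  have h4 : trd k (⊥ : Ideal (A ⧸ leftC P)) = trd k (leftC P) := by
    have := trd_comap_of_surjective hf ⊥
    rw [← this]
    exact congrArg _ (ker_mkₐ (k := k) (leftC P))
  have h5 := PrimeChain.of_leftC_eq_bot hP' h1
  rw [h2, h3, h4] at h5
  have h6 := h5.comap (tensorMap_surjective hf hg)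
  rw [hPP] at h6
  refine h6.mono_left (sup_le ?_ ?_)
  · refine le_trans ?_ (Ideal.comap_mono bot_le)
    have := ker_tensorMap hf hg
    rw [ker_mkₐ] at this
    exact le_trans le_sup_left this.ge
  · rw [Ideal.map_le_iff_le_comap]
    intro b hb
    have := Ideal.mem_map_of_mem
      (Algebra.TensorProduct.includeRight : B →ₐ[k] (A ⧸ leftC P) ⊗[k] B) hb
    simpa [Ideal.mem_comap] using this

omit [FinTr k B] in
theorem PrimeChain.of_right [IsDomain A] {q : Ideal B} {n : ℕ}
    (h : PrimeChain ⊥ n (q.map (MvPolynomial.C (σ := Fin (trd k (⊥ : Ideal A))))))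
    {V : Ideal (A ⊗[k] B)} (hV : V.IsPrime) (hq : q ≤ rightC V) : PrimeChain ⊥ n V := by
  obtain ⟨V', h1, h2, h3, h4⟩ := exists_le_leftC_eq (p := ⊥) hV bot_le hq
  obtain ⟨x, hx⟩ := exists_algebraicIndependent_fin (k := k) (A := A)
  refine PrimeChain.mono_right ?_ hV h2
  have := of_polyToTensor hx V' h3 (h.mono_right (h1.comap _) ?_)
  · exact this.mono_left bot_le
  · rw [Ideal.map_le_iff_le_comap]
    exact (comap_C_comap_polyToTensor x V').symm ▸ h4

theorem PrimeChain.of_left_of_right [IsDomain A] {p : Ideal A} {q : Ideal B} {n₁ n₂ : ℕ}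
    (h₁ : PrimeChain ⊥ n₁ (q.map (MvPolynomial.C (σ := Fin (trd k (⊥ : Ideal A))))))
    (h₂ : PrimeChain ⊥ n₂ p) {P : Ideal (A ⊗[k] B)} (hP : P.IsPrime) (hp : leftC P = p)
    (hq : rightC P = q) : PrimeChain ⊥ (n₁ + n₂ + (trd k p + trd k q - trd k P)) P := by
  subst hp hq
  refine concat (fun W hW hle => ?_) (of_contractions hP)
  have hlr := sup_le_iff.1 hle
  have hl := Ideal.map_le_iff_le_comap.1 hlr.1
  have hr := Ideal.map_le_iff_le_comap.1 hlr.2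
  refine concat (fun V hV hle => h₁.of_right hV ?_)
    (PrimeChain.lift_leftC hW hr (h₂.mono_right (hW.comap _) hl))
  exact Ideal.map_le_iff_le_comap.1 (sup_le_iff.1 hle).2

theorem exists_step {t : ℕ} {P P' : Ideal (A ⊗[k] B)} (hP : P.IsPrime) (hP' : P'.IsPrime)
    (hlt : P' < P) (ht : trd k (leftC P) ≤ t) :
    ∃ j, PrimeChain ((rightC P').map (MvPolynomial.C (σ := Fin t))) j
        ((rightC P).map (MvPolynomial.C (σ := Fin t))) ∧
      1 + trd k (rightC P') + trd k P ≤ trd k P' + trd k (rightC P) + j := by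
  have hq : (rightC P).IsPrime := hP.comap _
  have hq' : (rightC P').IsPrime := hP'.comap _
  have htd := trd_add_one_le (k := k) hlt
  obtain ⟨m, x, -, h1, h2, h3⟩ := exists_algebraicIndependent_trd P
  by_cases heq : rightC P' = rightC P
  · rw [heq]
    exact ⟨0, .refl (MvPolynomial.isPrime_map_C _ _), by omega⟩
  · let N := P'.comap (polyToTensor (k := k) (B := B) x)
    have hN : N.IsPrime := hP'.comap _
    have hNC : N.comap MvPolynomial.C = rightC P' := comap_C_comap_polyToTensor x P'
    have hle : N ≤ (rightC P).map MvPolynomial.C := h3 ▸ Ideal.comap_mono hlt.le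
    have hNlt : N < (rightC P).map MvPolynomial.C := by
      refine lt_of_le_of_ne hle fun h => heq ?_
      rw [← hNC, h, MvPolynomial.comap_C_map_C]
    have h4 := primeChain_mvPolynomial (k := k) N
    rw [hNC] at h4
    have h5 : trd k N ≤ trd k P' := trd_comap_le _ _
    refine ⟨_, PrimeChain.map_C_mono (h2.trans ht)
      (h4.succ_of_lt (MvPolynomial.isPrime_map_C _ _) hNlt), ?_⟩
    omega

theorem exists_primeChain_map_C {t n : ℕ} {P : Ideal (A ⊗[k] B)} (ht : ∀ p : Ideal A, p.IsPrime →
    trd k p ≤ t) (h : PrimeChain ⊥ n P) :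
    ∃ j, PrimeChain ⊥ j ((rightC P).map (MvPolynomial.C (σ := Fin t))) ∧
      n + trd k P ≤ t + j + trd k (rightC P) := by
  induction n generalizing P with
  | zero =>
    have hP := h.isPrime
    have hq : (rightC P).IsPrime := hP.comap _
    have := trd_le_add P
    have := ht (leftC P) (hP.comap _)
    exact ⟨0, ⟨MvPolynomial.isPrime_map_C _ _, bot_le⟩, by omega⟩
  | succ n ih =>
    obtain ⟨hP, P', hlt, h'⟩ := h
    obtain ⟨j, h1, h2⟩ := ih h'
    obtain ⟨j', h1', h2'⟩ := exists_step hP h'.isPrime hlt (ht _ (hP.comap _))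
    exact ⟨j + j', h1.trans h1', by omega⟩

theorem exists_le_trd_eq {p : Ideal A} (hp' : p.IsPrime) {q : Ideal B} (hq' : q.IsPrime)
    {W : Ideal (A ⊗[k] B)} (hW : W.IsPrime) (hp : p ≤ leftC W) (hq : q ≤ rightC W) :
    ∃ V : Ideal (A ⊗[k] B), V.IsPrime ∧ V ≤ W ∧ leftC V = p ∧ rightC V = q ∧
      trd k V = trd k p + trd k q := by
  obtain ⟨V, h1, h2, rfl, rfl⟩ := exists_le_contractions_eq hW hp hq
  obtain ⟨V', h3, h4, h5⟩ := (PrimeChain.of_contractions h1).exists_bot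
  have hlr := sup_le_iff.1 h4
  have hl : leftC V' = leftC V :=
    le_antisymm (Ideal.comap_mono h5.le) (Ideal.map_le_iff_le_comap.1 hlr.1)
  have hr : rightC V' = rightC V :=
    le_antisymm (Ideal.comap_mono h5.le) (Ideal.map_le_iff_le_comap.1 hlr.2)
  refine ⟨V', h3, h5.le.trans h2, hl, hr, ?_⟩
  have h6 := h5.trd_le (k := k)
  have h7 := trd_le_add (k := k) V'
  rw [hl, hr] at h7
  omega

end estimates

section pullback

variable {k T A D K : Type u} [Field k] [CommRing T] [CommRing A] [CommRing D] [Field K]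
  [Algebra k T] [Algebra k A] [Algebra k D] [Algebra k K]

/-- The square exhibiting `A` as the preimage in `T` of the subring `D` of the quotient field `K`
of `T`. -/
structure IsConductorSquare (ι : A →ₐ[k] T) (φ : T →ₐ[k] K) (ψ : A →ₐ[k] D) (j : D →ₐ[k] K) :
    Prop where
  injective_left : Function.Injective ι
  surjective_right : Function.Surjective φ
  surjective_left : Function.Surjective ψ
  injective_right : Function.Injective j
  comm : ∀ a, φ (ι a) = j (ψ a)
  exists_of_mem : ∀ u, φ u = 0 → ∃ a, ι a = u

namespace IsConductorSquare

variable {ι : A →ₐ[k] T} {φ : T →ₐ[k] K} {ψ : A →ₐ[k] D} {j : D →ₐ[k] K}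
  (h : IsConductorSquare ι φ ψ j)

include h

theorem map_mem_iff (a : A) : φ (ι a) = 0 ↔ ψ a = 0 := by
  rw [h.comm, map_eq_zero_iff _ h.injective_right]

theorem exists_not_mem {J : Ideal T} (hJ : ¬ RingHom.ker φ ≤ J) :
    ∃ a : A, ψ a = 0 ∧ ι a ∉ J := by
  obtain ⟨u, hu, hu'⟩ := SetLike.not_le_iff_exists.1 hJ
  obtain ⟨a, rfl⟩ := h.exists_of_mem u hu
  exact ⟨a, (h.map_mem_iff a).1 hu, hu'⟩

theorem exists_mul {a : A} (ha : ψ a = 0) (y : T) : ∃ b : A, ι b = ι a * y :=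
  h.exists_of_mem _ (by rw [map_mul, (h.map_mem_iff a).2 ha, zero_mul])

theorem comap_lt_comap {J' J : Ideal T} [hJ' : J'.IsPrime] (hlt : J' < J)
    (hM : ¬ RingHom.ker φ ≤ J') : J'.comap ι < J.comap ι := by
  obtain ⟨a, ha, haJ⟩ := h.exists_not_mem hM
  obtain ⟨v, hv, hv'⟩ := SetLike.exists_of_lt hlt
  obtain ⟨b, hb⟩ := h.exists_mul ha v
  refine SetLike.lt_iff_le_and_exists.2 ⟨Ideal.comap_mono hlt.le, b, ?_, ?_⟩
  · exact Ideal.mem_comap.2 (hb ▸ J.mul_mem_left _ hv)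
  · intro hbJ
    have : ι b ∈ J' := hbJ
    rw [hb] at this
    exact (hJ'.mem_or_mem this).elim haJ hv'

theorem primeChain_comap {I : Ideal T} {n : ℕ} {J : Ideal T} (hJ : PrimeChain I n J)
    (hM : ¬ RingHom.ker φ ≤ J) : PrimeChain (I.comap ι) n (J.comap ι) := by
  induction n generalizing J with
  | zero => exact ⟨hJ.1.comap ι, Ideal.comap_mono hJ.2⟩
  | succ n ih =>
    obtain ⟨hJp, J', hlt, h'⟩ := hJ
    have hM' : ¬ RingHom.ker φ ≤ J' := fun hle => hM (hle.trans hlt.le)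
    have := h'.isPrime
    exact ⟨hJp.comap ι, J'.comap ι, h.comap_lt_comap hlt hM', ih h' hM'⟩

theorem trd_comap {J : Ideal T} [hJ : J.IsPrime] (hM : ¬ RingHom.ker φ ≤ J) :
    trd k (J.comap ι) = trd k J := by
  obtain ⟨a, ha, haJ⟩ := h.exists_not_mem hM
  let f : A ⧸ J.comap ι →ₐ[k] T ⧸ J := Ideal.quotientMapₐ J ι le_rfl
  have hf : Function.Injective f := Ideal.quotientMap_injective (f := (ι : A →+* T))
  let : Algebra (A ⧸ J.comap ι) (T ⧸ J) := f.toAlgebra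
  have : IsScalarTower k (A ⧸ J.comap ι) (T ⧸ J) :=
    .of_algebraMap_eq fun c => (f.commutes c).symm
  have : FaithfulSMul (A ⧸ J.comap ι) (T ⧸ J) := (faithfulSMul_iff_algebraMap_injective _ _).2 hf
  have : Algebra.IsAlgebraic (A ⧸ J.comap ι) (T ⧸ J) := by
    refine ⟨fun y => ?_⟩
    obtain ⟨y, rfl⟩ := Ideal.Quotient.mk_surjective y
    obtain ⟨b, hb⟩ := h.exists_mul ha y
    let p : Polynomial (A ⧸ J.comap ι) := Polynomial.C (Ideal.Quotient.mk _ a) * Polynomial.X -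
      Polynomial.C (Ideal.Quotient.mk _ b)
    refine ⟨p, fun hp => haJ ?_, ?_⟩
    · have : p.coeff 1 = Ideal.Quotient.mk _ a := by simp [p, Polynomial.coeff_C]
      rw [hp, Polynomial.coeff_zero, eq_comm, Ideal.Quotient.eq_zero_iff_mem] at this
      exact this
    · have h1 : algebraMap (A ⧸ J.comap ι) (T ⧸ J) (Ideal.Quotient.mk _ a) =
        Ideal.Quotient.mk J (ι a) := rfl
      have h2 : algebraMap (A ⧸ J.comap ι) (T ⧸ J) (Ideal.Quotient.mk _ b) =
        Ideal.Quotient.mk J (ι b) := rfl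
      simp [p, h1, h2, hb]
  rw [trd, trd]
  congr 1
  have h1 := trdeg_add_eq k (A ⧸ J.comap ι) (A := T ⧸ J)
  rw [trdeg_eq_zero_iff.2 this] at h1
  simpa using h1

/-- The prime of `T` over a prime of `A` not containing the conductor. -/
theorem exists_over {p : Ideal A} (hp : p.IsPrime) (hM : ¬ RingHom.ker ψ ≤ p) :
    ∃ J : Ideal T, J.IsPrime ∧ J.comap ι = p ∧ ¬ RingHom.ker φ ≤ J := by
  obtain ⟨a, ha, hap⟩ := SetLike.not_le_iff_exists.1 hM
  have ha : ψ a = 0 := ha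
  let J : Ideal T :=
    { carrier := {y | ∃ b ∈ p, ι b = ι a * y}
      zero_mem' := ⟨0, p.zero_mem, by simp⟩
      add_mem' := by
        rintro y z ⟨b, hb, hb'⟩ ⟨c, hc, hc'⟩
        exact ⟨b + c, p.add_mem hb hc, by rw [map_add, hb', hc', mul_add]⟩
      smul_mem' := by
        rintro r y ⟨b, hb, hb'⟩
        obtain ⟨c, hc⟩ := h.exists_mul ha (r * y)
        obtain ⟨e, he⟩ := h.exists_mul ha r
        refine ⟨c, (hp.mem_or_mem (x := a) ?_).resolve_left hap, hc⟩
        have : a * c = e * b := h.injective_left (by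
          rw [map_mul, map_mul, hc, he, hb']; ring)
        exact this ▸ p.mul_mem_left _ hb }
  have hmem : ∀ y b, ι b = ι a * y → (y ∈ J ↔ b ∈ p) := fun y b hb =>
    ⟨fun ⟨c, hc, hc'⟩ => h.injective_left (hc'.trans hb.symm) ▸ hc, fun hbp => ⟨b, hbp, hb⟩⟩
  refine ⟨J, ⟨?_, ?_⟩, ?_, ?_⟩
  · rw [Ne, Ideal.eq_top_iff_one, hmem 1 a (by simp)]
    exact hap
  · intro y z hyz
    obtain ⟨b, hb⟩ := h.exists_mul ha y
    obtain ⟨c, hc⟩ := h.exists_mul ha z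
    obtain ⟨e, he⟩ := h.exists_mul ha (y * z)
    rw [hmem _ _ hb, hmem _ _ hc]
    rw [hmem _ _ he] at hyz
    refine hp.mem_or_mem ?_
    have : b * c = a * e := h.injective_left (by
      rw [map_mul, map_mul, hb, hc, he]; ring)
    exact this ▸ p.mul_mem_left _ hyz
  · ext b
    rw [Ideal.mem_comap, hmem (ι b) (a * b) (map_mul _ _ _)]
    exact ⟨fun hb => (hp.mem_or_mem hb).resolve_left hap, p.mul_mem_left _⟩
  · intro hle
    have : ι a ∈ J := hle ((h.map_mem_iff a).2 ha)
    rw [hmem (ι a) (a * a) (map_mul _ _ _)] at this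
    exact (hp.mem_or_mem this).elim hap hap

theorem le_ker {J : Ideal T} {p : Ideal A} (hp : p.IsPrime) (hM : RingHom.ker ψ ≤ p)
    (hJ : J.comap ι ≤ p) : J ≤ RingHom.ker φ := by
  intro y hy
  by_contra hyM
  have hy0 : φ y ≠ 0 := hyM
  obtain ⟨z, hz⟩ := h.surjective_right (φ y)⁻¹
  obtain ⟨m, hm⟩ := h.exists_of_mem (1 - z * y) (by
    rw [map_sub, map_mul, hz, inv_mul_cancel₀ hy0, map_one, sub_self])
  have h1 : m ∈ p := hM ((h.map_mem_iff m).1 (by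
    rw [hm, map_sub, map_mul, hz, inv_mul_cancel₀ hy0, map_one, sub_self]))
  have h2 : 1 - m ∈ p := hJ (by
    rw [Ideal.mem_comap, map_sub, map_one, hm, sub_sub_cancel]
    exact J.mul_mem_left _ hy)
  exact hp.ne_top ((Ideal.eq_top_iff_one _).2 (by simpa using p.add_mem h2 h1))

theorem trd_add_one_le [FinTr k T] {p p₁ : Ideal A} (hp : p.IsPrime) (hM : ¬ RingHom.ker ψ ≤ p)
    (hp₁ : p₁.IsPrime) (hM₁ : RingHom.ker ψ ≤ p₁) (hle : p ≤ p₁) :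
    trd k (RingHom.ker φ) + 1 ≤ trd k p := by
  obtain ⟨J, hJ, rfl, hJM⟩ := h.exists_over hp hM
  rw [h.trd_comap hJM]
  have hK : (RingHom.ker φ).IsPrime := RingHom.ker_isPrime φ
  exact _root_.trd_add_one_le (lt_of_le_not_ge (h.le_ker hp₁ hM₁ hle) hJM)

theorem primeChain_of_not_le [IsDomain T] {t : ℕ}
    (hT : ∀ J : Ideal T, J.IsPrime → PrimeChain ⊥ (t - trd k J) J) {p : Ideal A} (hp : p.IsPrime)
    (hM : ¬ RingHom.ker ψ ≤ p) : PrimeChain ⊥ (t - trd k p) p := by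
  obtain ⟨J, hJ, rfl, hJM⟩ := h.exists_over hp hM
  rw [h.trd_comap hJM]
  exact (h.primeChain_comap (hT J hJ) hJM).mono_left bot_le

end IsConductorSquare

end pullback

section upperBound

variable {k T A D K B : Type u} [Field k] [CommRing T] [CommRing A] [CommRing D] [Field K]
  [CommRing B] [Algebra k T] [Algebra k A] [Algebra k D] [Algebra k K] [Algebra k B]

namespace IsConductorSquare

variable {ι : A →ₐ[k] T} {φ : T →ₐ[k] K} {ψ : A →ₐ[k] D} {j : D →ₐ[k] K}
  (h : IsConductorSquare ι φ ψ j)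

include h

theorem finTr_left [IsDomain T] [FinTr k T] : FinTr k A :=
  .of_trdeg ((trdeg_le_of_injective ι h.injective_left).trans_lt trdeg_lt)

theorem finTr_right [IsDomain T] [FinTr k T] : FinTr k D :=
  have := h.finTr_left
  .of_surjective ψ h.surjective_left

theorem trd_le_trd_bot [IsDomain D] [FinTr k D] {p : Ideal A} (hp : p.IsPrime)
    (hM : RingHom.ker ψ ≤ p) : trd k p ≤ trd k (⊥ : Ideal D) := by
  have h1 : (p.map ψ).IsPrime := Ideal.map_isPrime_of_surjective h.surjective_left hM
  have h2 : (p.map ψ).comap ψ = p := by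
    rw [Ideal.comap_map_of_surjective _ h.surjective_left]
    exact sup_eq_left.2 hM
  rw [← h2, trd_comap_of_surjective h.surjective_left]
  exact trd_anti bot_le

theorem trd_le_trd_ker [IsDomain D] [FinTr k T] :
    trd k (⊥ : Ideal D) ≤ trd k (RingHom.ker φ) := by
  have : FinTr k K := .of_surjective φ h.surjective_right
  have h1 : trd k (RingHom.ker φ) = trd k (⊥ : Ideal K) :=
    trd_comap_of_surjective h.surjective_right ⊥
  have h2 : (⊥ : Ideal D) = (⊥ : Ideal K).comap j :=
    ((RingHom.injective_iff_ker_eq_bot j.toRingHom).1 h.injective_right).symm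
  rw [h1, h2]
  exact trd_comap_le _ _

theorem trd_le_trd_bot_left [IsDomain A] [IsDomain T] [FinTr k T] {p : Ideal A} (hp : p.IsPrime) :
    trd k p ≤ trd k (⊥ : Ideal T) := by
  have := h.finTr_left
  refine (trd_anti bot_le).trans ?_
  have h2 : (⊥ : Ideal A) = (⊥ : Ideal T).comap ι :=
    ((RingHom.injective_iff_ker_eq_bot ι.toRingHom).1 h.injective_left).symm
  rw [h2]
  exact trd_comap_le _ _

variable [IsDomain A] [IsDomain T] [IsDomain D] [FinTr k T] [FinTr k B]

theorem exists_bound {n : ℕ} {P : Ideal (A ⊗[k] B)} (hM : RingHom.ker ψ ≤ leftC P)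
    (hn : PrimeChain ⊥ n P) :
    (∃ j, PrimeChain ⊥ j ((rightC P).map (MvPolynomial.C (σ := Fin (trd k (⊥ : Ideal D))))) ∧
      n + trd k P ≤ trd k (⊥ : Ideal D) + j + trd k (rightC P)) ∨
    (¬ RingHom.ker φ ≤ ⊥ ∧ ∃ q : Ideal B, q.IsPrime ∧ q ≤ rightC P ∧ ∃ i j,
      PrimeChain ⊥ i (q.map (MvPolynomial.C (σ := Fin (trd k (⊥ : Ideal T))))) ∧
      PrimeChain (q.map (MvPolynomial.C (σ := Fin (trd k (⊥ : Ideal D))))) j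
        ((rightC P).map (MvPolynomial.C (σ := Fin (trd k (⊥ : Ideal D))))) ∧
      n + trd k P + (trd k (RingHom.ker φ) - trd k (⊥ : Ideal D)) ≤
        trd k (⊥ : Ideal T) + i + j + trd k (rightC P) +
          min (trd k (RingHom.ker φ) - trd k (⊥ : Ideal D)) (trd k q)) := by
  have := h.finTr_left
  have := h.finTr_right
  have hse := h.trd_le_trd_ker
  induction n generalizing P with
  | zero =>
    left
    have hP := hn.isPrime
    have hq : (rightC P).IsPrime := hP.comap _
    have h1 := trd_le_add P
    have h2 : trd k (leftC P) ≤ _ := h.trd_le_trd_bot (hP.comap _) hM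
    exact ⟨0, ⟨MvPolynomial.isPrime_map_C _ _, bot_le⟩, by omega⟩
  | succ n ih =>
    obtain ⟨hP, P', hlt, hn'⟩ := hn
    have hP' := hn'.isPrime
    have hq : (rightC P).IsPrime := hP.comap _
    have hq' : (rightC P').IsPrime := hP'.comap _
    have hqle : rightC P' ≤ rightC P := Ideal.comap_mono hlt.le
    have hPs : trd k (leftC P) ≤ _ := h.trd_le_trd_bot (hP.comap _) hM
    obtain ⟨j', hj', hle'⟩ := exists_step hP hP' hlt hPs
    by_cases hM' : RingHom.ker ψ ≤ leftC P'
    · rcases ih hM' hn' with ⟨j, h1, h2⟩ | ⟨h0, q, h1, h2, i, j, h3, h4, h5⟩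
      · exact Or.inl ⟨j + j', h1.trans hj', by omega⟩
      · exact Or.inr ⟨h0, q, h1, h2.trans hqle, i, j + j', h3, h4.trans hj', by omega⟩
    · right
      obtain ⟨i, hi, hle⟩ := exists_primeChain_map_C (fun p => h.trd_le_trd_bot_left (p := p)) hn'
      refine ⟨fun h0 => hM' fun a ha => ?_, rightC P', hq', hqle, i, ?_⟩
      · have h1 : ι a ∈ RingHom.ker φ := (h.map_mem_iff a).2 ha
        have h2 : ι a = 0 := h0 h1
        rw [map_eq_zero_iff _ h.injective_left] at h2
        rw [h2]
        exact zero_mem _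
      · by_cases hb : trd k (RingHom.ker φ) - trd k (⊥ : Ideal D) ≤ trd k (rightC P')
        · refine ⟨j', hi, hj', ?_⟩
          rw [min_eq_left hb]
          omega
        · have h1 := h.trd_add_one_le (hP'.comap _) hM' (hP.comap _) hM (Ideal.comap_mono hlt.le)
          have h2 : trd k (leftC P') ≤ trd k P' := trd_comap_le _ _
          have h3 := trd_le_add P
          refine ⟨0, hi, ⟨MvPolynomial.isPrime_map_C _ _, Ideal.map_mono hqle⟩, ?_⟩
          rw [min_eq_right (le_of_not_ge hb)]
          change trd k (RingHom.ker φ) + 1 ≤ trd k (leftC P') at h1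
          omega

end IsConductorSquare

end upperBound

section lowerBound

theorem MvPolynomial.comap_map_map_C {R S : Type*} [CommRing R] [CommRing S] (f : R →+* S)
    (σ : Type*) (I : Ideal S) :
    (I.map (MvPolynomial.C (σ := σ))).comap (MvPolynomial.map f) =
      (I.comap f).map MvPolynomial.C := by
  ext p
  rw [Ideal.mem_comap, MvPolynomial.mem_map_C_iff, MvPolynomial.mem_map_C_iff]
  simp [MvPolynomial.coeff_map, Ideal.mem_comap]

variable {k T A D K B : Type u} [Field k] [CommRing T] [CommRing A] [CommRing D] [Field K]
  [CommRing B] [Algebra k T] [Algebra k A] [Algebra k D] [Algebra k K] [Algebra k B]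

namespace IsConductorSquare

variable {ι : A →ₐ[k] T} {φ : T →ₐ[k] K} {ψ : A →ₐ[k] D} {j : D →ₐ[k] K}
  (h : IsConductorSquare ι φ ψ j)

include h
variable [IsDomain T] [IsDomain D] [FinTr k T] [FinTr k B]

theorem primeChain_over_ker
    (hD : ∀ J : Ideal D, J.IsPrime → PrimeChain ⊥ (trd k (⊥ : Ideal D) - trd k J) J)
    {Q : Ideal (A ⊗[k] B)} (hQ : Q.IsPrime) (hM : RingHom.ker ψ ≤ leftC Q)
    {q : Ideal B} {m : ℕ}
    (hm : PrimeChain (q.map (MvPolynomial.C (σ := Fin (trd k (⊥ : Ideal D))))) m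
      ((rightC Q).map (MvPolynomial.C (σ := Fin (trd k (⊥ : Ideal D)))))) :
    PrimeChain ((RingHom.ker ψ).map (Algebra.TensorProduct.includeLeft : A →ₐ[k] A ⊗[k] B) ⊔
      q.map (Algebra.TensorProduct.includeRight : B →ₐ[k] A ⊗[k] B))
      (trd k (⊥ : Ideal D) + m + trd k (rightC Q) - trd k Q) Q := by
  have := h.finTr_left
  have := h.finTr_right
  have hq : q ≤ rightC Q := by
    have := Ideal.comap_mono (f := MvPolynomial.C (σ := Fin (trd k (⊥ : Ideal D)))) hm.le
    rwa [MvPolynomial.comap_C_map_C, MvPolynomial.comap_C_map_C] at this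
  have hg := Ideal.Quotient.mkₐ_surjective k q
  let F := Algebra.TensorProduct.map ψ (Ideal.Quotient.mkₐ k q)
  have hF : Function.Surjective F := tensorMap_surjective h.surjective_left hg
  obtain ⟨Q', hQ', hQQ⟩ := exists_comap_tensorMap h.surjective_left hg hQ hM (by rwa [ker_mkₐ])
  have hQQ' : Q'.comap F = Q := hQQ
  have h1 : (leftC Q').comap ψ = leftC Q := by rw [← hQQ', leftC_comap_map]
  have h2 : (rightC Q').comap (Ideal.Quotient.mkₐ k q) = rightC Q := by
    rw [← hQQ', rightC_comap_map]
  have h3 : trd k Q' = trd k Q := by rw [← hQQ', trd_comap_of_surjective hF]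
  have h4 : trd k (rightC Q') = trd k (rightC Q) := by rw [← h2, trd_comap_of_surjective hg]
  have h5 : PrimeChain ⊥ m
      ((rightC Q').map (MvPolynomial.C (σ := Fin (trd k (⊥ : Ideal D))))) := by
    have hsurj : Function.Surjective (Ideal.Quotient.mkₐ k q).toRingHom := hg
    refine PrimeChain.of_comap (MvPolynomial.map_surjective _ hsurj) ?_
    have h6 := MvPolynomial.comap_map_map_C (Ideal.Quotient.mkₐ k q).toRingHom
      (Fin (trd k (⊥ : Ideal D))) (rightC Q')
    have h7 := MvPolynomial.comap_map_map_C (Ideal.Quotient.mkₐ k q).toRingHom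
      (Fin (trd k (⊥ : Ideal D))) ⊥
    rw [Ideal.map_bot] at h7
    rw [h6, h7]
    have h8 : (⊥ : Ideal (B ⧸ q)).comap (Ideal.Quotient.mkₐ k q).toRingHom = q :=
      ker_mkₐ (k := k) q
    have h9 : (rightC Q').comap (Ideal.Quotient.mkₐ k q).toRingHom = rightC Q := h2
    rwa [h8, h9]
  have h6 := (PrimeChain.of_left_of_right h5 (hD _ (hQ'.comap _)) hQ' rfl rfl).comap hF
  have h7 := trd_le_add Q'
  have h8 : trd k (leftC Q') ≤ trd k (⊥ : Ideal D) := by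
    have : (leftC Q').IsPrime := hQ'.comap _
    exact trd_anti bot_le
  have h9 : RingHom.ker F.toRingHom = _ := ker_tensorMap h.surjective_left hg
  rw [ker_mkₐ] at h9
  have h10 : (Q'.comap F.toRingHom) = Q := hQQ
  rw [← h9]
  have h11 := h6.of_le (m := trd k (⊥ : Ideal D) + m + trd k (rightC Q) - trd k Q) (by
    change trd k (⊥ : Ideal D) + m + trd k (rightC Q) - trd k Q ≤
      m + (trd k (⊥ : Ideal D) - trd k (leftC Q')) +
        (trd k (leftC Q') + trd k (rightC Q') - trd k Q')
    omega)
  have h12 : PrimeChain (RingHom.ker F.toRingHom) _ (Q'.comap F.toRingHom) := h11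
  rwa [h10] at h12

end IsConductorSquare

end lowerBound

section roof

variable {k T A D K B : Type u} [Field k] [CommRing T] [CommRing A] [CommRing D] [Field K]
  [CommRing B] [Algebra k T] [Algebra k A] [Algebra k D] [Algebra k K] [Algebra k B]

theorem trd_add_le_of_common {G : Type u} [CommRing G] [IsDomain G] [Algebra k G] [FinTr k A]
    [FinTr k B] [IsDomain T] [FinTr k T] (ι : A →ₐ[k] T) (f : T →ₐ[k] G) (g : B →ₐ[k] G)
    {V : Ideal (A ⊗[k] B)} (hVp : V.IsPrime)
    (hV : ∀ z, z ∈ V ↔ Algebra.TensorProduct.productMap (f.comp ι) g z = 0) {c : ℕ} {x : Fin c → T}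
    {z : Fin c → B} (hxz : ∀ l, f (x l) = g (z l)) (hz : AlgebraicIndependent k (g ∘ z)) :
    trd k V + c ≤ trd k (⊥ : Ideal T) + trd k (rightC V) := by
  let mk := Ideal.Quotient.mkₐ k V
  let f' := mk.comp (Algebra.TensorProduct.includeLeft : A →ₐ[k] A ⊗[k] B)
  let g' := mk.comp (Algebra.TensorProduct.includeRight : B →ₐ[k] A ⊗[k] B)
  obtain ⟨m, x', hx', hm⟩ := exists_algebraicIndependent_range f' g'
    (tensor_range_sup (Ideal.Quotient.mkₐ_surjective k V))
  have hkg : RingHom.ker g' = rightC V := by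
    ext a; exact Ideal.Quotient.eq_zero_iff_mem
  have hq : (rightC V).IsPrime := hVp.comap _
  rw [hkg, ← cast_trd] at hm
  have hm' : trd k (rightC V) + m = trd k V := by
    have := cast_trd (k := k) V
    rw [← hm] at this
    exact_mod_cast this.symm
  let θ : (A ⊗[k] B) ⧸ V →ₐ[k] G := Ideal.Quotient.liftₐ V
    (Algebra.TensorProduct.productMap (f.comp ι) g) fun a ha => (hV a).1 ha
  have hθ : Function.Injective θ := by
    rw [injective_iff_map_eq_zero]
    intro y hy
    obtain ⟨y, rfl⟩ := Ideal.Quotient.mk_surjective y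
    exact Ideal.Quotient.eq_zero_iff_mem.2 ((hV y).2 hy)
  have hθf : ∀ a, θ (f' a) = f (ι a) := fun a => by
    change Algebra.TensorProduct.productMap (f.comp ι) g (a ⊗ₜ 1) = _
    simp
  have hθg : ∀ b, θ (g' b) = g b := fun b => by
    change Algebra.TensorProduct.productMap (f.comp ι) g (1 ⊗ₜ b) = _
    simp
  have hz' : AlgebraicIndependent k (fun l => g'.rangeRestrict (z l)) := by
    refine AlgebraicIndependent.of_comp (θ.comp g'.range.val) ?_
    convert hz using 1
    ext l
    exact hθg _
  have h1 := hz'.sumElim_comp hx'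
  have h2 := h1.map' hθ
  have h3 : AlgebraicIndependent k (Sum.elim (ι ∘ x') x) := by
    refine AlgebraicIndependent.of_comp f ?_
    convert h2 using 1
    ext (l | l)
    · exact (hθf _).symm
    · exact (hxz l).trans (hθg _).symm
  have h4 := h3.lift_cardinalMk_le_trdeg
  have h5 : (trd k (⊥ : Ideal T) : Cardinal) = Algebra.trdeg k T := by
    rw [trd_bot, Cardinal.cast_toNat_of_lt_aleph0 trdeg_lt]
  rw [← h5] at h4
  have h6 : m + c ≤ trd k (⊥ : Ideal T) := by
    have h6 : (m : Cardinal.{u}) + c ≤ trd k (⊥ : Ideal T) := by simpa using h4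
    exact_mod_cast h6
  omega

namespace IsConductorSquare

variable {ι : A →ₐ[k] T} {φ : T →ₐ[k] K} {ψ : A →ₐ[k] D} {j : D →ₐ[k] K}
  (h : IsConductorSquare ι φ ψ j)

include h

theorem exists_map_eq {a : A} (ha : ψ a = 0) (y : T ⊗[k] B) :
    ∃ z : A ⊗[k] B, Algebra.TensorProduct.map ι (AlgHom.id k B) z = (ι a ⊗ₜ 1) * y := by
  induction y with
  | zero => exact ⟨0, by simp⟩
  | add y₁ y₂ h₁ h₂ =>
    obtain ⟨z₁, hz₁⟩ := h₁
    obtain ⟨z₂, hz₂⟩ := h₂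
    exact ⟨z₁ + z₂, by rw [map_add, hz₁, hz₂, mul_add]⟩
  | tmul t b =>
    obtain ⟨a', ha'⟩ := h.exists_mul ha t
    exact ⟨a' ⊗ₜ b, by simp [ha']⟩

variable [IsDomain T] [IsDomain A] [FinTr k T] [FinTr k B]

theorem primeChain_of_mem_iff {G : Type u} [CommRing G] [IsDomain G] [Algebra k G]
    (f : T →ₐ[k] G) (hf : ∀ t, f t = 0 ↔ t = 0) (g : B →ₐ[k] G)
    {q : Ideal B} (hg : ∀ b, g b = 0 ↔ b ∈ q)
    {V : Ideal (A ⊗[k] B)} (hVp : V.IsPrime)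
    (hV : ∀ z, z ∈ V ↔ Algebra.TensorProduct.productMap (f.comp ι) g z = 0)
    {c : ℕ} {x : Fin c → T} {z : Fin c → B} (hxz : ∀ l, f (x l) = g (z l))
    (hz : AlgebraicIndependent k (Ideal.Quotient.mkₐ k q ∘ z)) (hM : ¬ RingHom.ker φ ≤ ⊥)
    {i : ℕ} (hi : PrimeChain ⊥ i (q.map (MvPolynomial.C (σ := Fin (trd k (⊥ : Ideal T)))))) :
    PrimeChain ⊥ (c + i) V := by
  have := h.finTr_left
  have hι : (⊥ : Ideal T).comap ι = ⊥ :=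
    (RingHom.injective_iff_ker_eq_bot ι.toRingHom).1 h.injective_left
  have hA : trd k (⊥ : Ideal A) = trd k (⊥ : Ideal T) := by
    rw [← h.trd_comap hM, hι]
  have hl : leftC V = ⊥ := by
    rw [← hι]
    ext a
    refine (hV _).trans ?_
    simp [hf, Ideal.mem_comap]
  have hr : rightC V = q := by
    ext b
    refine (hV _).trans ?_
    simp [hg]
  rw [← hA] at hi
  have h1 := PrimeChain.of_left_of_right hi (.refl Ideal.isPrime_bot) hVp hl hr
  let θ : B ⧸ q →ₐ[k] G := Ideal.Quotient.liftₐ q g fun b hb => (hg b).2 hb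
  have hθ : Function.Injective θ := by
    rw [injective_iff_map_eq_zero]
    intro y hy
    obtain ⟨y, rfl⟩ := Ideal.Quotient.mk_surjective y
    exact Ideal.Quotient.eq_zero_iff_mem.2 ((hg y).1 hy)
  have h2 : AlgebraicIndependent k (g ∘ z) := by
    have h4 := hz.map' hθ
    have h5 : θ ∘ Ideal.Quotient.mkₐ k q ∘ z = g ∘ z := funext fun l => Ideal.Quotient.lift_mk q _ _
    exact h5 ▸ h4
  have h3 := trd_add_le_of_common ι f g hVp hV hxz h2
  rw [hr] at h3
  exact h1.of_le (by omega)

theorem primeChain_comap_productMap {W : Type u} [CommRing W] [Algebra k W] [Algebra T W]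
    [IsScalarTower k T W] [Algebra.HasGoingDown T W] (g : B →ₐ[k] W)
    {q : Ideal B} (hq : ∀ b ∈ q, g b = 0) (hu : ∀ b ∉ q, IsUnit (g b))
    (hd : ∀ y : W, ∃ b ∉ q, ∃ z : T ⊗[k] B,
      Algebra.TensorProduct.productMap (IsScalarTower.toAlgHom k T W) g z = g b * y)
    {c : ℕ} {x : Fin c → T} {z : Fin c → B} (hxz : ∀ l, algebraMap T W (x l) = g (z l))
    (hz : AlgebraicIndependent k (Ideal.Quotient.mkₐ k q ∘ z)) (hM : ¬ RingHom.ker φ ≤ ⊥)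
    {i : ℕ} (hi : PrimeChain ⊥ i (q.map (MvPolynomial.C (σ := Fin (trd k (⊥ : Ideal T))))))
    {n : ℕ} {w : Ideal W} (hw : w.IsPrime) (hwM : w.comap (algebraMap T W) ≤ RingHom.ker φ)
    (hn : PrimeChain ⊥ n (w.comap (algebraMap T W))) :
    PrimeChain ⊥ (n + c + i) (w.comap (Algebra.TensorProduct.productMap
      ((IsScalarTower.toAlgHom k T W).comp ι) g)) := by
  have := h.finTr_left
  let Ψ := Algebra.TensorProduct.productMap ((IsScalarTower.toAlgHom k T W).comp ι) g
  have hΨ : ∀ y, Algebra.TensorProduct.productMap (IsScalarTower.toAlgHom k T W) g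
      (Algebra.TensorProduct.map ι (AlgHom.id k B) y) = Ψ y := fun y => by
    induction y with
    | zero => simp
    | add _ _ h1 h2 => rw [map_add, map_add, h1, h2, map_add]
    | tmul a b => simp [Ψ]
  have hgq : ∀ w : Ideal W, w.IsPrime → w.comap g = q := fun w hw => by
    ext b
    refine ⟨fun hb => ?_, fun hb => ?_⟩
    · by_contra hbq
      exact hw.ne_top (Ideal.eq_top_of_isUnit_mem _ hb (hu b hbq))
    · rw [Ideal.mem_comap, hq b hb]
      exact zero_mem _
  have hr : ∀ w : Ideal W, w.IsPrime → rightC (w.comap Ψ) = q := fun w hw => by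
    rw [← hgq w hw]
    ext b
    simp [rightC, Ψ, Ideal.mem_comap]
  induction n generalizing w with
  | zero =>
    have : w.LiesOver (w.comap (algebraMap T W)) := ⟨rfl⟩
    obtain ⟨w₀, h1, h2, h3⟩ := w.exists_ideal_le_liesOver_of_le
      (p := ⊥) (q := w.comap (algebraMap T W)) bot_le
    have h3' : w₀.comap (algebraMap T W) = ⊥ := h3.over.symm
    refine PrimeChain.mono_right ?_ (hw.comap _) (Ideal.comap_mono h1)
    have hg₀ : ∀ b, Ideal.Quotient.mkₐ k w₀ (g b) = 0 ↔ b ∈ q := fun b => by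
      rw [← hgq _ h2]
      exact Ideal.Quotient.eq_zero_iff_mem (I := w₀)
    have := h.primeChain_of_mem_iff ((Ideal.Quotient.mkₐ k w₀).comp
      (IsScalarTower.toAlgHom k T W)) ?_ ((Ideal.Quotient.mkₐ k w₀).comp g) hg₀
      (h2.comap Ψ) ?_ (fun l => congrArg (Ideal.Quotient.mkₐ k w₀) (hxz l)) hz hM hi
    · simpa using this
    · intro t
      rw [← Ideal.mem_bot (x := t), ← h3']
      exact Ideal.Quotient.eq_zero_iff_mem (I := w₀)
    · intro y
      have : Algebra.TensorProduct.productMap (((Ideal.Quotient.mkₐ k w₀).comp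
          (IsScalarTower.toAlgHom k T W)).comp ι) ((Ideal.Quotient.mkₐ k w₀).comp g) y =
          Ideal.Quotient.mkₐ k w₀ (Ψ y) := by
        induction y with
        | zero => simp
        | add _ _ h1 h2 => rw [map_add, h1, h2, map_add, map_add]
        | tmul a b => simp [Ψ]
      rw [this]
      exact (Ideal.Quotient.eq_zero_iff_mem (I := w₀)).symm
  | succ n ih =>
    obtain ⟨-, m, hlt, hn'⟩ := hn
    have hm := hn'.isPrime
    have : w.LiesOver (w.comap (algebraMap T W)) := ⟨rfl⟩
    obtain ⟨w', h1, h2, h3⟩ := Ideal.exists_ideal_lt_liesOver_of_lt (p := m)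
      (q := w.comap (algebraMap T W)) w hlt
    have h3' : w'.comap (algebraMap T W) = m := h3.over.symm
    have key := ih h2 (h3' ▸ hlt.le.trans hwM) (h3' ▸ hn')
    have hlt' : w'.comap Ψ < w.comap Ψ := by
      obtain ⟨a, ha, ham⟩ := h.exists_not_mem (fun hle => (hlt.trans_le hwM).not_ge hle)
      obtain ⟨y, hy, hy'⟩ := SetLike.exists_of_lt h1
      obtain ⟨b, hb, v, hv⟩ := hd y
      obtain ⟨v', hv'⟩ := h.exists_map_eq ha v
      have hval : Ψ v' = algebraMap T W (ι a) * (g b * y) := by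
        rw [← hΨ, hv', map_mul, hv]
        simp
      refine SetLike.lt_iff_le_and_exists.2 ⟨Ideal.comap_mono h1.le, v', ?_, ?_⟩
      · rw [Ideal.mem_comap, hval]
        exact w.mul_mem_left _ (w.mul_mem_left _ hy)
      · intro hmem
        rw [Ideal.mem_comap, hval] at hmem
        rcases h2.mem_or_mem hmem with h4 | h4
        · exact ham (h3' ▸ h4)
        · rcases h2.mem_or_mem h4 with h5 | h5
          · exact h2.ne_top (Ideal.eq_top_of_isUnit_mem _ h5 (hu b hb))
          · exact hy' h5
    exact (key.succ_of_lt (hw.comap _) hlt').of_le (by omega)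

end IsConductorSquare

end roof

section amalgam

theorem exists_field_comp_eq {R K F : Type u} [CommRing R] [Field K] [Field F] (f : R →+* K)
    (g : R →+* F) (hf : Function.Injective f) (hg : Function.Injective g) :
    ∃ (Ω : Type u) (_ : Field Ω) (u : K →+* Ω) (v : F →+* Ω), u.comp f = v.comp g := by
  let _ : Algebra R K := f.toAlgebra
  let _ : Algebra R F := g.toAlgebra
  have : Nontrivial (K ⊗[R] F) :=
    Algebra.TensorProduct.nontrivial_of_algebraMap_injective_of_isDomain R K F hf hg
  obtain ⟨m, hm⟩ := Ideal.exists_maximal (K ⊗[R] F)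
  refine ⟨(K ⊗[R] F) ⧸ m, Ideal.Quotient.field m,
    (Ideal.Quotient.mk m).comp Algebra.TensorProduct.includeLeftRingHom,
    (Ideal.Quotient.mk m).comp
      (Algebra.TensorProduct.includeRight : F →ₐ[R] K ⊗[R] F).toRingHom, ?_⟩
  ext r
  exact congrArg (Ideal.Quotient.mk m)
    (Algebra.TensorProduct.tmul_one_eq_one_tmul (A := K) (B := F) r)

theorem exists_amalgam {k D K E : Type u} [Field k] [CommRing D] [Field K] [CommRing E] [IsDomain E]
    [Algebra k D] [Algebra k K] [Algebra k E] (j : D →ₐ[k] K) (f : D →ₐ[k] E) {c : ℕ}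
    {y : Fin c → K} {z : Fin c → E}
    (hy : Function.Injective (MvPolynomial.eval₂Hom j.toRingHom y))
    (hz : Function.Injective (MvPolynomial.eval₂Hom f.toRingHom z)) :
    ∃ (Ω : Type u) (_ : Field Ω) (_ : Algebra k Ω) (u : K →ₐ[k] Ω) (v : E →ₐ[k] Ω),
      Function.Injective v ∧ (∀ d, u (j d) = v (f d)) ∧ ∀ l, u (y l) = v (z l) := by
  obtain ⟨Ω, _, u, v, huv⟩ := exists_field_comp_eq (MvPolynomial.eval₂Hom j.toRingHom y)
    ((algebraMap E (FractionRing E)).comp (MvPolynomial.eval₂Hom f.toRingHom z)) hy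
    ((IsFractionRing.injective E (FractionRing E)).comp hz)
  have h1 : ∀ d, u (j d) = v (algebraMap E (FractionRing E) (f d)) := fun d => by
    simpa using RingHom.congr_fun huv (MvPolynomial.C d)
  have h2 : ∀ l, u (y l) = v (algebraMap E (FractionRing E) (z l)) := fun l => by
    simpa using RingHom.congr_fun huv (MvPolynomial.X l)
  let _ : Algebra k Ω := (u.comp (algebraMap k K)).toAlgebra
  refine ⟨Ω, _, inferInstance, { u with commutes' := fun _ => rfl },
    { v.comp (algebraMap E (FractionRing E)) with commutes' := fun r => ?_ },
    v.injective.comp (IsFractionRing.injective E (FractionRing E)), h1, h2⟩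
  have h3 := h1 (algebraMap k D r)
  rw [j.commutes, f.commutes] at h3
  exact h3.symm

end amalgam

section cover

variable {k T A D K B : Type u} [Field k] [CommRing T] [CommRing A] [CommRing D] [Field K]
  [CommRing B] [Algebra k T] [Algebra k A] [Algebra k D] [Algebra k K] [Algebra k B]

/-- A flat `T`-algebra receiving `B`, in which given elements of `T` and `B` are identified. -/
theorem exists_flat_cover {κ Ω : Type u} [Field Ω] [Algebra k Ω]
    {q : Ideal B} [hq : q.IsPrime] [Field κ] [Algebra (B ⧸ q) κ] [IsFractionRing (B ⧸ q) κ]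
    (u : T →ₐ[k] Ω) (v : B →ₐ[k] Ω)
    (hv : ∀ b, v b = 0 ↔ b ∈ q) {c : ℕ} {x : Fin c → T} {z : Fin c → B}
    (hxz : ∀ l, u (x l) = v (z l))
    (hz : AlgebraicIndependent k (Ideal.Quotient.mkₐ k q ∘ z)) :
    ∃ (W : Type u) (_ : CommRing W) (_ : Algebra k W) (_ : Algebra T W) (_ : IsScalarTower k T W)
      (_ : Algebra.HasGoingDown T W) (g : B →ₐ[k] W) (π : W →+* Ω),
      (∀ b ∈ q, g b = 0) ∧ (∀ b ∉ q, IsUnit (g b)) ∧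
      (∀ y : W, ∃ b ∉ q, ∃ z : T ⊗[k] B,
        Algebra.TensorProduct.productMap (IsScalarTower.toAlgHom k T W) g z = g b * y) ∧
      (∀ l, algebraMap T W (x l) = g (z l)) ∧
      (∀ t, π (algebraMap T W t) = u t) ∧ (∀ b, π (g b) = v b) := by
  let C := MvPolynomial (Fin c) k
  let _ : Algebra k κ := ((algebraMap (B ⧸ q) κ).comp (algebraMap k (B ⧸ q))).toAlgebra
  let β : B →ₐ[k] κ :=
    { (algebraMap (B ⧸ q) κ).comp (Ideal.Quotient.mk q) with commutes' := fun _ => rfl }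
  have hβ : ∀ b, β b = 0 ↔ b ∈ q := fun b => by
    rw [← Ideal.Quotient.eq_zero_iff_mem (I := q)]
    exact map_eq_zero_iff _ (IsFractionRing.injective (B ⧸ q) κ)
  have hβs : ∀ r : κ, ∃ b ∉ q, ∃ a, β a = β b * r := fun r => by
    obtain ⟨a, b, hb, rfl⟩ := IsFractionRing.div_surjective (A := B ⧸ q) r
    obtain ⟨a, rfl⟩ := Ideal.Quotient.mk_surjective a
    obtain ⟨b, rfl⟩ := Ideal.Quotient.mk_surjective b
    have hbq : b ∉ q := fun h => nonZeroDivisors.ne_zero hb (Ideal.Quotient.eq_zero_iff_mem.2 h)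
    refine ⟨b, hbq, a, ?_⟩
    have := mt (hβ b).1 hbq
    exact (mul_div_cancel₀ _ this).symm
  let _ : Algebra C T := (MvPolynomial.aeval x : C →ₐ[k] T).toRingHom.toAlgebra
  let _ : Algebra C κ := (MvPolynomial.aeval (β ∘ z) : C →ₐ[k] κ).toRingHom.toAlgebra
  let _ : Algebra C Ω := (MvPolynomial.aeval (u ∘ x) : C →ₐ[k] Ω).toRingHom.toAlgebra
  have : IsScalarTower k C T := .of_algebraMap_eq fun r =>
    ((MvPolynomial.aeval x : C →ₐ[k] T).commutes r).symm
  have : IsScalarTower k C κ := .of_algebraMap_eq fun r =>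
    ((MvPolynomial.aeval (β ∘ z) : C →ₐ[k] κ).commutes r).symm
  have hβz : Function.Injective (MvPolynomial.aeval (β ∘ z) : C →ₐ[k] κ) := by
    let α : B ⧸ q →ₐ[k] κ := { algebraMap (B ⧸ q) κ with commutes' := fun _ => rfl }
    exact hz.map' (f := α) (IsFractionRing.injective (B ⧸ q) κ)
  have : Module.Flat C κ := .of_injective_field C κ hβz
  let v₁ : B ⧸ q →+* Ω := Ideal.Quotient.lift q v.toRingHom fun b hb => (hv b).2 hb
  have hv₁ : Function.Injective v₁ := by
    rw [injective_iff_map_eq_zero]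
    intro y hy
    obtain ⟨y, rfl⟩ := Ideal.Quotient.mk_surjective y
    exact Ideal.Quotient.eq_zero_iff_mem.2 ((hv y).1 hy)
  let v₂ : κ →+* Ω := IsFractionRing.lift hv₁
  have hv₂ : ∀ b, v₂ (β b) = v b := fun b => IsFractionRing.lift_algebraMap hv₁ _
  let uC : T →ₐ[C] Ω := { u.toRingHom with
    commutes' := fun p => by
      change u (MvPolynomial.aeval x p) = MvPolynomial.aeval (u ∘ x) p
      rw [← AlgHom.comp_apply, MvPolynomial.comp_aeval]
      rfl }
  let vC : κ →ₐ[C] Ω := { v₂ with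
    commutes' := fun p => by
      change v₂ (MvPolynomial.aeval (β ∘ z) p) = MvPolynomial.aeval (u ∘ x) p
      have hr : v₂.comp (algebraMap k κ) = algebraMap k Ω := RingHom.ext fun r =>
        (congrArg v₂ (β.commutes r).symm).trans ((hv₂ _).trans (v.commutes r))
      rw [MvPolynomial.aeval_def, MvPolynomial.aeval_def, MvPolynomial.hom_eval₂, hr]
      congr 1
      exact funext fun l => (hv₂ (z l)).trans (hxz l).symm }
  let g : B →ₐ[k] T ⊗[C] κ :=
    ((Algebra.TensorProduct.includeRight : κ →ₐ[C] T ⊗[C] κ).restrictScalars k).comp β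
  have hg : ∀ b, g b = 1 ⊗ₜ β b := fun _ => rfl
  refine ⟨T ⊗[C] κ, inferInstance, inferInstance, inferInstance, inferInstance, inferInstance, g,
    (Algebra.TensorProduct.productMap uC vC).toRingHom, ?_, ?_, ?_, ?_, ?_, ?_⟩
  · intro b hb
    rw [hg, (hβ b).2 hb, tmul_zero]
  · intro b hb
    exact (isUnit_iff_ne_zero.2 (mt (hβ b).1 hb)).map
      (Algebra.TensorProduct.includeRight : κ →ₐ[C] T ⊗[C] κ)
  · intro y
    induction y with
    | zero => exact ⟨1, hq.one_notMem, 0, by simp⟩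
    | add y₁ y₂ h₁ h₂ =>
      obtain ⟨b₁, hb₁, z₁, h₁⟩ := h₁
      obtain ⟨b₂, hb₂, z₂, h₂⟩ := h₂
      refine ⟨b₁ * b₂, fun h => (hq.mem_or_mem h).elim hb₁ hb₂, (1 ⊗ₜ b₂) * z₁ + (1 ⊗ₜ b₁) * z₂, ?_⟩
      rw [map_add, map_mul, map_mul, h₁, h₂, map_mul]
      simp only [Algebra.TensorProduct.productMap_apply_tmul, map_one, one_mul]
      ring
    | tmul t r =>
      obtain ⟨b, hb, a, ha⟩ := hβs r
      refine ⟨b, hb, t ⊗ₜ a, ?_⟩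
      rw [Algebra.TensorProduct.productMap_apply_tmul, hg, hg, ha]
      change (t ⊗ₜ[C] (1 : κ)) * _ = _
      simp
  · intro l
    have h1 : algebraMap C T (MvPolynomial.X l) = x l := MvPolynomial.aeval_X _ l
    have h2 : algebraMap C κ (MvPolynomial.X l) = β (z l) := MvPolynomial.aeval_X _ l
    rw [hg, ← h1, ← h2]
    exact Algebra.TensorProduct.tmul_one_eq_one_tmul _
  · intro t
    change Algebra.TensorProduct.productMap uC vC (t ⊗ₜ 1) = _
    rw [Algebra.TensorProduct.productMap_apply_tmul, map_one, mul_one]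
    rfl
  · intro b
    rw [hg]
    change Algebra.TensorProduct.productMap uC vC (1 ⊗ₜ β b) = _
    rw [Algebra.TensorProduct.productMap_apply_tmul, map_one, one_mul]
    exact hv₂ b

end cover

section lowerBound

variable {k T A D K B : Type u} [Field k] [CommRing T] [CommRing A] [CommRing D] [Field K]
  [CommRing B] [Algebra k T] [Algebra k A] [Algebra k D] [Algebra k K] [Algebra k B]

/-- Given `c` at most the transcendence degree of `K` over `D`, there are `c` elements of `K`
algebraically independent over `D`. -/
theorem exists_injective_eval₂Hom [IsDomain D] [FinTr k K] (j : D →ₐ[k] K)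
    (hj : Function.Injective j) {c : ℕ}
    (hc : trd k (⊥ : Ideal D) + c ≤ trd k (⊥ : Ideal K)) :
    ∃ y : Fin c → K, Function.Injective (MvPolynomial.eval₂Hom j.toRingHom y) := by
  let _ : Algebra D K := j.toRingHom.toAlgebra
  have : IsScalarTower k D K := .of_algebraMap_eq fun r => (j.commutes r).symm
  have : FaithfulSMul D K := (faithfulSMul_iff_algebraMap_injective D K).2 hj
  have : FaithfulSMul k D :=
    (faithfulSMul_iff_algebraMap_injective k D).2 (algebraMap k D).injective
  have h1 := trdeg_add_eq k D (A := K)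
  have hD : Algebra.trdeg k D < Cardinal.aleph0 := (trdeg_le_of_injective j hj).trans_lt trdeg_lt
  obtain ⟨ι, y, hy⟩ := exists_isTranscendenceBasis' D K
  have h2 : (trd k (⊥ : Ideal D) : Cardinal) = Algebra.trdeg k D := by
    rw [trd_bot, Cardinal.cast_toNat_of_lt_aleph0 hD]
  have h3 : (trd k (⊥ : Ideal K) : Cardinal) = Algebra.trdeg k K := by
    rw [trd_bot, Cardinal.cast_toNat_of_lt_aleph0 trdeg_lt]
  rw [← h2, ← h3, ← hy.cardinalMk_eq_trdeg] at h1
  have h4 : Cardinal.mk ι < Cardinal.aleph0 :=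
    (self_le_add_left _ _).trans_lt (h1 ▸ Cardinal.natCast_lt_aleph0)
  obtain ⟨n, hn⟩ := Cardinal.lt_aleph0.1 h4
  rw [hn] at h1
  have h5 : trd k (⊥ : Ideal D) + n = trd k (⊥ : Ideal K) := by exact_mod_cast h1
  obtain ⟨e⟩ := Cardinal.mk_eq_nat_iff.1 hn
  have hcn : c ≤ n := by omega
  refine ⟨y ∘ e.symm ∘ Fin.castLE hcn, ?_⟩
  exact hy.1.comp _ (e.symm.injective.comp (Fin.castLE_injective hcn))

namespace IsConductorSquare

variable {ι : A →ₐ[k] T} {φ : T →ₐ[k] K} {ψ : A →ₐ[k] D} {j : D →ₐ[k] K}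
  (h : IsConductorSquare ι φ ψ j)

include h
variable [IsDomain T] [IsDomain A] [FinTr k T] [FinTr k B]

theorem primeChain_of_common {Ω : Type u} [Field Ω] [Algebra k Ω] (u : K →ₐ[k] Ω) (v : B →ₐ[k] Ω)
    {q : Ideal B} (hqp : q.IsPrime) (hv : ∀ b, v b = 0 ↔ b ∈ q) {c : ℕ} {x : Fin c → T}
    {z : Fin c → B} (hxz : ∀ l, u (φ (x l)) = v (z l))
    (hz : AlgebraicIndependent k (Ideal.Quotient.mkₐ k q ∘ z)) (hM : ¬ RingHom.ker φ ≤ ⊥)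
    {i : ℕ} (hi : PrimeChain ⊥ i (q.map (MvPolynomial.C (σ := Fin (trd k (⊥ : Ideal T))))))
    {n : ℕ} (hn : PrimeChain ⊥ n (RingHom.ker φ)) {V : Ideal (A ⊗[k] B)}
    (hV : ∀ y, y ∈ V ↔ Algebra.TensorProduct.productMap ((u.comp φ).comp ι) v y = 0) :
    PrimeChain ⊥ (n + c + i) V := by
  obtain ⟨W, _, _, _, _, _, g, π, h1, h2, h3, h4, h5, h6⟩ :=
    exists_flat_cover (κ := FractionRing (B ⧸ q)) (u.comp φ) v hv hxz hz
  have hw : (RingHom.ker π).comap (algebraMap T W) = RingHom.ker φ := by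
    ext t
    rw [Ideal.mem_comap, RingHom.mem_ker, h5, RingHom.mem_ker]
    exact map_eq_zero_iff u u.injective
  have hp := h.primeChain_comap_productMap g h1 h2 h3 h4 hz hM hi (RingHom.ker_isPrime π) hw.le
    (hw ▸ hn)
  convert hp using 1
  ext y
  rw [hV, Ideal.mem_comap, RingHom.mem_ker]
  have : π (Algebra.TensorProduct.productMap ((IsScalarTower.toAlgHom k T W).comp ι) g y) =
      Algebra.TensorProduct.productMap ((u.comp φ).comp ι) v y := by
    induction y with
    | zero => simp
    | add _ _ h1 h2 => rw [map_add, map_add, h1, h2, map_add]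
    | tmul a b => simp [h5, h6]
  rw [this]

theorem primeChain_bot_of_ker_le [IsDomain D]
    (hT : PrimeChain ⊥ (trd k (⊥ : Ideal T) - trd k (RingHom.ker φ)) (RingHom.ker φ))
    (hM : ¬ RingHom.ker φ ≤ ⊥) {q : Ideal B} (hqp : q.IsPrime) {c : ℕ}
    (hc : trd k (⊥ : Ideal D) + c ≤ trd k (RingHom.ker φ)) (hcq : c ≤ trd k q)
    {i : ℕ} (hi : PrimeChain ⊥ i (q.map (MvPolynomial.C (σ := Fin (trd k (⊥ : Ideal T))))))
    {S : Ideal (A ⊗[k] B)} (hS : S.IsPrime) (hSA : RingHom.ker ψ ≤ leftC S) (hSB : q ≤ rightC S) :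
    PrimeChain ⊥ (trd k (⊥ : Ideal T) - trd k (RingHom.ker φ) + c + i) S := by
  have := h.finTr_left
  have : FinTr k K := .of_surjective φ h.surjective_right
  obtain ⟨V, hVp, hVS, hl, hr, htr⟩ := exists_le_trd_eq (RingHom.ker_isPrime ψ) hqp hS hSA hSB
  refine PrimeChain.mono_right ?_ hS hVS
  have hK : trd k (⊥ : Ideal K) = trd k (RingHom.ker φ) :=
    (trd_comap_of_surjective h.surjective_right ⊥).symm
  obtain ⟨y, hy⟩ := exists_injective_eval₂Hom j h.injective_right (hK ▸ hc)
  have hψp : (RingHom.ker ψ).IsPrime := RingHom.ker_isPrime ψ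
  let mk := Ideal.Quotient.mkₐ k V
  let f := mk.comp (Algebra.TensorProduct.includeRight : B →ₐ[k] A ⊗[k] B)
  let g := mk.comp (Algebra.TensorProduct.includeLeft : A →ₐ[k] A ⊗[k] B)
  obtain ⟨m, z, hz, hm⟩ := exists_algebraicIndependent_range f g
    (sup_comm g.range f.range ▸ tensor_range_sup (Ideal.Quotient.mkₐ_surjective k V))
  have hkg : RingHom.ker g = RingHom.ker ψ := by
    rw [← hl]; ext a; exact Ideal.Quotient.eq_zero_iff_mem
  have hkf : ∀ b, f b = 0 ↔ b ∈ q := fun b => by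
    rw [← hr]; exact Ideal.Quotient.eq_zero_iff_mem
  have hm' : trd k (RingHom.ker ψ) + m = trd k V := by
    have h1 := cast_trd (k := k) V
    have h2 := cast_trd (k := k) (RingHom.ker ψ)
    rw [hkg, ← h2, ← h1] at hm
    exact_mod_cast hm
  have hcm : c ≤ m := by omega
  obtain ⟨fD, hfD⟩ : ∃ fD : D →ₐ[k] (A ⊗[k] B) ⧸ V, ∀ a, fD (ψ a) = g a := by
    let g' := Ideal.Quotient.liftₐ (RingHom.ker ψ) g fun a ha => by rwa [← hkg] at ha
    refine ⟨g'.comp (Ideal.quotientKerAlgEquivOfSurjective h.surjective_left).symm.toAlgHom,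
      fun a => ?_⟩
    have : (Ideal.quotientKerAlgEquivOfSurjective h.surjective_left).symm (ψ a) =
        Ideal.Quotient.mk _ a := by
      rw [AlgEquiv.symm_apply_eq]
      rfl
    exact congrArg g' this
  have hz' : Function.Injective (MvPolynomial.eval₂Hom fD.toRingHom
    ((f ∘ z) ∘ Fin.castLE hcm)) := by
    have hfr : ∀ d, fD.toRingHom d ∈ g.range := fun d => by
      obtain ⟨a, rfl⟩ := h.surjective_left d
      exact ⟨a, (hfD a).symm⟩
    let ρ : D →+* g.range := fD.toRingHom.codRestrict g.range hfr
    have hρ : Function.Injective ρ := by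
      rw [injective_iff_map_eq_zero]
      intro d hd
      obtain ⟨a, rfl⟩ := h.surjective_left d
      have h1 : g a = 0 := (hfD a).symm.trans (congrArg Subtype.val hd)
      have h2 : a ∈ RingHom.ker ψ := hkg ▸ h1
      exact h2
    have h4 := (hz.comp _ (Fin.castLE_injective hcm))
    have h5 : Function.Injective (MvPolynomial.aeval ((f ∘ z) ∘ Fin.castLE hcm) :
      MvPolynomial (Fin c) g.range →ₐ[g.range] _) := h4
    have h6 : MvPolynomial.eval₂Hom fD.toRingHom ((f ∘ z) ∘ Fin.castLE hcm) =
        (MvPolynomial.aeval ((f ∘ z) ∘ Fin.castLE hcm) :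
          MvPolynomial (Fin c) g.range →ₐ[g.range] _).toRingHom.comp (MvPolynomial.map ρ) := by
      refine MvPolynomial.ringHom_ext (fun d => ?_) fun l => ?_
      · simp only [RingHom.comp_apply, MvPolynomial.map_C, MvPolynomial.coe_eval₂Hom,
          MvPolynomial.eval₂_C]
        exact (MvPolynomial.aeval_C ((f ∘ z) ∘ Fin.castLE hcm) (ρ d)).symm
      · simp only [RingHom.comp_apply, MvPolynomial.map_X, MvPolynomial.coe_eval₂Hom,
          MvPolynomial.eval₂_X]
        exact (MvPolynomial.aeval_X _ _).symm
    rw [h6]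
    exact h5.comp (MvPolynomial.map_injective _ hρ)
  obtain ⟨Ω, _, _, u, v, h1, h2, h3⟩ := exists_amalgam j fD hy hz'
  choose x hx using fun l => h.surjective_right (y l)
  refine h.primeChain_of_common u (v.comp f) hqp (x := x) (z := z ∘ Fin.castLE hcm) ?_ ?_ ?_ hM hi
    hT ?_
  · intro b
    rw [← hkf]
    exact map_eq_zero_iff v h1
  · intro l
    rw [hx]
    exact h3 l
  · let θ : B ⧸ q →ₐ[k] (A ⊗[k] B) ⧸ V := Ideal.Quotient.liftₐ q f fun b hb => (hkf b).2 hb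
    have h4 := (hz.comp _ (Fin.castLE_injective hcm)).restrictScalars (R := k)
      (algebraMap k g.range).injective
    refine AlgebraicIndependent.of_comp θ ?_
    exact h4
  · intro w
    have : Algebra.TensorProduct.productMap ((u.comp φ).comp ι) (v.comp f) w = v (mk w) := by
      induction w with
      | zero => simp
      | add _ _ h1 h2 => rw [map_add, map_add, h1, h2, map_add]
      | tmul a b =>
        have h5 : a ⊗ₜ[k] b = (a ⊗ₜ 1) * (1 ⊗ₜ b) := by simp
        have h6 : mk (a ⊗ₜ 1) = fD (ψ a) := (hfD a).symm
        rw [Algebra.TensorProduct.productMap_apply_tmul, h5, map_mul, map_mul, h6, ← h2, ← h.comm]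
        rfl
    rw [this, map_eq_zero_iff v h1]
    exact Ideal.Quotient.eq_zero_iff_mem.symm

end IsConductorSquare

end lowerBound

section special

variable {k T A D K B : Type u} [Field k] [CommRing T] [CommRing A] [CommRing D] [Field K]
  [CommRing B] [Algebra k T] [Algebra k A] [Algebra k D] [Algebra k K] [Algebra k B]

namespace IsConductorSquare

variable {ι : A →ₐ[k] T} {φ : T →ₐ[k] K} {ψ : A →ₐ[k] D} {j : D →ₐ[k] K}
  (h : IsConductorSquare ι φ ψ j)

include h
variable [IsDomain T] [IsDomain A] [IsDomain D] [FinTr k T] [FinTr k B]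

theorem primeChain_of_contractions_le
    (hT : ∀ J : Ideal T, J.IsPrime → PrimeChain ⊥ (trd k (⊥ : Ideal T) - trd k J) J)
    (hD : ∀ J : Ideal D, J.IsPrime → PrimeChain ⊥ (trd k (⊥ : Ideal D) - trd k J) J)
    {P Q : Ideal (A ⊗[k] B)} {n : ℕ} (hn : PrimeChain ⊥ n P) (hQ : Q.IsPrime)
    (hl : leftC P ≤ leftC Q) (hr : rightC P ≤ rightC Q) :
    PrimeChain ⊥ (n - (trd k (leftC P) + trd k (rightC P) - trd k P)) Q := by
  have := h.finTr_left
  have := h.finTr_right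
  have hP := hn.isPrime
  have hlp : (leftC P).IsPrime := hP.comap _
  have hrp : (rightC P).IsPrime := hP.comap _
  obtain ⟨Q₀, h1, h2, h3, h4, h5⟩ := exists_le_trd_eq hlp hrp hQ hl hr
  refine PrimeChain.mono_right ?_ hQ h2
  have hadd : trd k P ≤ trd k (leftC P) + trd k (rightC P) := trd_le_add P
  have hφ : (RingHom.ker φ).IsPrime := RingHom.ker_isPrime φ
  have hψ : (RingHom.ker ψ).IsPrime := RingHom.ker_isPrime ψ
  by_cases hM : RingHom.ker ψ ≤ leftC P
  · have hps : trd k (leftC P) ≤ trd k (⊥ : Ideal D) := h.trd_le_trd_bot hlp hM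
    have hse : trd k (⊥ : Ideal D) ≤ trd k (RingHom.ker φ) := h.trd_le_trd_ker
    have het : trd k (RingHom.ker φ) ≤ trd k (⊥ : Ideal T) := trd_anti bot_le
    rcases h.exists_bound hM hn with ⟨m, h6, h7⟩ | ⟨hφ0, q, hq, hqr, i, m, h6, h7, h8⟩
    · have h9 := h.primeChain_over_ker hD h1 (h3 ▸ hM) (q := ⊥) (m := m)
        (by rw [Ideal.map_bot, h4]; exact h6)
      rw [h4] at h9
      exact (h9.mono_left bot_le).of_le (by omega)
    · have h9 := h.primeChain_over_ker hD h1 (h3 ▸ hM) (h4 ▸ h7)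
      rw [h4] at h9
      have h10 := PrimeChain.concat (I := ⊥) (fun W hW hle =>
        h.primeChain_bot_of_ker_le (hT _ hφ) hφ0 hq
          (c := min (trd k (RingHom.ker φ) - trd k (⊥ : Ideal D)) (trd k q))
          (by omega) (by omega) h6 hW (Ideal.map_le_iff_le_comap.1 (sup_le_iff.1 hle).1)
          (Ideal.map_le_iff_le_comap.1 (sup_le_iff.1 hle).2)) h9
      exact h10.of_le (by omega)
  · obtain ⟨m, h6, h7⟩ := exists_primeChain_map_C (t := trd k (⊥ : Ideal T))
      (fun p hp => h.trd_le_trd_bot_left hp) hn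
    have hφ0 : ¬ RingHom.ker φ ≤ ⊥ := fun hle => hM fun a ha => by
      have h8 : ι a ∈ (⊥ : Ideal T) := hle ((h.map_mem_iff a).2 ha)
      have h9 : a = 0 := h.injective_left ((Ideal.mem_bot.1 h8).trans (map_zero ι).symm)
      rw [h9]
      exact zero_mem _
    have hι : (⊥ : Ideal T).comap ι = ⊥ :=
      (RingHom.injective_iff_ker_eq_bot ι.toRingHom).1 h.injective_left
    have hA : trd k (⊥ : Ideal A) = trd k (⊥ : Ideal T) := by
      rw [← h.trd_comap hφ0, hι]
    have hpt : trd k (leftC P) ≤ trd k (⊥ : Ideal T) := h.trd_le_trd_bot_left hlp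
    have h8 := h.primeChain_of_not_le hT hlp hM
    rw [← hA] at h6
    have h9 := PrimeChain.of_left_of_right h6 h8 h1 h3 h4
    exact h9.of_le (by omega)

end IsConductorSquare

end special

section dimension

theorem ENat.add_le_of_forall_natCast {a b c : ℕ∞}
    (h : ∀ m n : ℕ, (m : ℕ∞) ≤ a → (n : ℕ∞) ≤ b → ((m + n : ℕ) : ℕ∞) ≤ c) : a + b ≤ c := by
  have ha : a ≤ c := ENat.forall_natCast_le_iff_le.1 fun m hm => by simpa using h m 0 hm bot_le
  have hb : b ≤ c := ENat.forall_natCast_le_iff_le.1 fun n hn => by simpa using h 0 n bot_le hn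
  rcases eq_or_ne c ⊤ with rfl | hc
  · exact le_top
  lift a to ℕ using ne_top_of_le_ne_top hc ha
  lift b to ℕ using ne_top_of_le_ne_top hc hb
  exact_mod_cast h a b le_rfl le_rfl

theorem natCast_le_idealHt_iff {R : Type u} [CommRing R] {I : Ideal R} {n : ℕ} :
    (n : ℕ∞) ≤ idealHt I ↔ ∀ Q : Ideal R, Q.IsPrime → I ≤ Q → PrimeChain ⊥ n Q := by
  refine ⟨fun h Q hQ hle => ?_, fun h => le_iInf fun Q => ?_⟩
  · exact (PrimeChain.le_height_iff hQ).1 (h.trans (iInf_le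
      (fun P : { P : PrimeSpectrum R // I ≤ P.asIdeal } => Order.height P.1) ⟨⟨Q, hQ⟩, hle⟩))
  · exact (PrimeChain.le_height_iff Q.1.2).2 (h _ Q.1.2 Q.2)

theorem natCast_le_idealHt_iff_of_isPrime {R : Type u} [CommRing R] {P : Ideal R} (hP : P.IsPrime)
    {n : ℕ} : (n : ℕ∞) ≤ idealHt P ↔ PrimeChain ⊥ n P := by
  rw [natCast_le_idealHt_iff]
  exact ⟨fun h => h P hP le_rfl, fun h Q hQ hle => h.mono_right hQ hle⟩

theorem idealHt_eq_add {R : Type u} [CommRing R] {I P : Ideal R} {d : ℕ} (hd : PrimeChain I d P)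
    (h : ∀ n, PrimeChain ⊥ n P → ∀ Q : Ideal R, Q.IsPrime → I ≤ Q → PrimeChain ⊥ (n - d) Q) :
    idealHt P = idealHt I + idealHt (P.map (Ideal.Quotient.mk I)) := by
  have hP := hd.isPrime
  have hIP := hd.le
  have hs : Function.Surjective (Ideal.Quotient.mk I) := Ideal.Quotient.mk_surjective
  have hk : RingHom.ker (Ideal.Quotient.mk I) = I := Ideal.mk_ker
  have hP' : (P.map (Ideal.Quotient.mk I)).IsPrime :=
    Ideal.map_isPrime_of_surjective hs (hk.le.trans hIP)
  have hc : (P.map (Ideal.Quotient.mk I)).comap (Ideal.Quotient.mk I) = P := by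
    rw [Ideal.comap_map_of_surjective _ hs, ← RingHom.ker_eq_comap_bot, hk, sup_eq_left]
    exact hIP
  have hchain : ∀ n, PrimeChain ⊥ n (P.map (Ideal.Quotient.mk I)) ↔ PrimeChain I n P := fun n => by
    refine ⟨fun h => ?_, fun h => .of_comap hs ?_⟩
    · have := h.comap_bot hs
      rwa [hk, hc] at this
    · rw [hc, ← RingHom.ker_eq_comap_bot, hk]
      exact h
  refine le_antisymm ?_ ?_
  · refine ENat.forall_natCast_le_iff_le.1 fun n hn => ?_
    have h1 := (natCast_le_idealHt_iff_of_isPrime hP).1 hn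
    have h2 := natCast_le_idealHt_iff.2 (h n h1)
    have h3 := (natCast_le_idealHt_iff_of_isPrime hP').2 ((hchain d).2 hd)
    refine le_trans ?_ (add_le_add h2 h3)
    norm_cast
    omega
  · refine ENat.add_le_of_forall_natCast fun m n hm hn => ?_
    rw [natCast_le_idealHt_iff] at hm
    rw [natCast_le_idealHt_iff_of_isPrime hP', hchain] at hn
    exact (natCast_le_idealHt_iff_of_isPrime hP).2 (PrimeChain.concat hm hn)

variable {k : Type v} {R : Type u} [Field k] [CommRing R] [Algebra k R]

theorem FinTr.of_eTrdeg (h : eTrdeg k R ≠ ⊤) : FinTr k R :=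
  .of_trdeg (Cardinal.toENat_lt_top.1 h.lt_top)

theorem natCast_trd [FinTr k R] (J : Ideal R) [J.IsPrime] :
    (trd k J : ℕ∞) = eTrdeg k (R ⧸ J) := by
  change _ = Cardinal.toENat (Algebra.trdeg k (R ⧸ J))
  rw [← cast_trd, Cardinal.toENat_nat]

theorem natCast_trd_bot [IsDomain R] [FinTr k R] : (trd k (⊥ : Ideal R) : ℕ∞) = eTrdeg k R := by
  change _ = Cardinal.toENat (Algebra.trdeg k R)
  rw [← (AlgEquiv.quotientBot k R).trdeg_eq, ← cast_trd, Cardinal.toENat_nat]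

theorem IsAFDomain.primeChain [IsDomain R] [FinTr k R] (h : IsAFDomain k R) {J : Ideal R}
    (hJ : J.IsPrime) : PrimeChain ⊥ (trd k (⊥ : Ideal R) - trd k J) J := by
  refine (natCast_le_idealHt_iff_of_isPrime hJ).1 ?_
  have h1 := h J hJ
  rw [← natCast_trd, ← natCast_trd_bot] at h1
  rw [ENat.natCast_sub]
  exact tsub_le_iff_right.2 h1.ge

end dimension

/-- the pullback `A = φ⁻¹(D)` with `T`, `D` AF-domains and `t.d.(K:D) ≤ 2` is a GAF-domain. -/
theorem stmt_17 (k T : Type) [Field k] [CommRing T] [IsDomain T] [Algebra k T]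
    (hTfin : eTrdeg k T ≠ ⊤)
    (M : Ideal T) [hM : M.IsMaximal]
    (D : Subalgebra k (T ⧸ M))
    (A : Subalgebra k T) (hA : A = D.comap (Ideal.Quotient.mkₐ k M))
    (hTAF : IsAFDomain k T) (hDAF : IsAFDomain k ↥D)
    (hKD2 : eTrdeg (↥D) (T ⧸ M) ≤ 2) :
    IsGAFDomain k ↥A := by
  have hMp : M.IsPrime := hM.isPrime
  let _ : Field (T ⧸ M) := Ideal.Quotient.field M
  have : FinTr k T := .of_eTrdeg hTfin
  let ψ : A →ₐ[k] D := ((Ideal.Quotient.mkₐ k M).comp A.val).codRestrict D fun a => hA.le a.2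
  have h : IsConductorSquare A.val (Ideal.Quotient.mkₐ k M) ψ D.val := by
    refine ⟨Subtype.val_injective, Ideal.Quotient.mkₐ_surjective k M, fun d => ?_,
      Subtype.val_injective, fun _ => rfl, fun u hu => ?_⟩
    · obtain ⟨t, ht⟩ := Ideal.Quotient.mkₐ_surjective k M d.1
      refine ⟨⟨t, hA ▸ ?_⟩, Subtype.ext ht⟩
      change Ideal.Quotient.mkₐ k M t ∈ D
      exact ht ▸ d.2
    · refine ⟨⟨u, hA ▸ ?_⟩, rfl⟩
      change Ideal.Quotient.mkₐ k M u ∈ D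
      exact hu ▸ zero_mem D
  have := h.finTr_left
  have := h.finTr_right
  intro B _ _ hB P hP p hp q hq
  have : FinTr k B := .of_eTrdeg hB
  subst hp hq
  exact idealHt_eq_add (PrimeChain.of_contractions hP) fun n hn Q hQ hle =>
    h.primeChain_of_contractions_le (fun _ hJ => hTAF.primeChain hJ)
      (fun _ hJ => hDAF.primeChain hJ) hn hQ (Ideal.map_le_iff_le_comap.1 (sup_le_iff.1 hle).1)
      (Ideal.map_le_iff_le_comap.1 (sup_le_iff.1 hle).2)
end
end

section
/- For every field k and every positive integer r, there exists a k-algebra V of finite transcendence degree over k which is a valuation domain of Krull dimension r, of the form V = K + M with K a field and M the maximal ideal of V, such that V is an AF-domain. -/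
open TensorProduct

noncomputable section

/-- A witness for STATEMENT 19: a `k`-algebra `V` of finite transcendence degree over `k`
which is a valuation domain of Krull dimension `r`, of the form `V = K + M` with `K` a
field mapping isomorphically onto `V/M` and `M` the maximal ideal of `V`, and which is an
AF-domain. -/
structure AFValuationWitness (k : Type) [Field k] (r : ℕ) where
  /-- the underlying ring -/
  V : Type
  [commRing : CommRing V]
  [isDomain : IsDomain V]
  [algebra : Algebra k V]
  /-- `V` is a valuation domain -/
  [valuationRing : ValuationRing V]
  /-- `V` has finite transcendence degree over `k` -/
  finite_trdeg : eTrdeg k V ≠ ⊤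
  /-- `V` has Krull dimension `r` -/
  dim_eq : ringKrullDim V = r
  /-- `V` is an AF-domain -/
  af : IsAFDomain k V
  /-- the field `K` inside `V` -/
  K : Subring V
  K_isField : IsField ↥K
  /-- every element of `V` is the sum of an element of `K` and an element of the
  maximal ideal `M`: `V = K + M` -/
  add_decomp : ∀ v : V, ∃ c ∈ K, v - c ∈ IsLocalRing.maximalIdeal V
  /-- `K ∩ M = 0`, so `K` maps isomorphically onto `V/M` -/
  inter_eq_bot : ∀ c ∈ K, c ∈ IsLocalRing.maximalIdeal V → c = 0

section CompositeRing

open Polynomial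

/-- The pullback of (the image of) `A` along an `A`-algebra homomorphism `L → K`. -/
abbrev compositeRing {A K L : Type*} [CommRing A] [Field K] [Algebra A K] [CommRing L]
    [Algebra A L] (π : L →ₐ[A] K) : Subalgebra A L :=
  (⊥ : Subalgebra A K).comap π

namespace compositeRing

variable {A K L : Type*} [CommRing A] [Field K] [Algebra A K] [CommRing L]
  [Algebra A L] (π : L →ₐ[A] K)

lemma mem_of_map_eq_zero {x : L} (hx : π x = 0) : x ∈ compositeRing π := by
  rw [Subalgebra.mem_comap, hx]
  exact zero_mem _

lemma isUnit_of_map_ne_zero [IsLocalRing L] (hπ : Function.Surjective π) {x : L}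
    (hx : π x ≠ 0) : IsUnit x :=
  (IsLocalHom.of_surjective π.toRingHom hπ).map_nonunit x hx.isUnit

lemma valuationRing [IsDomain A] [ValuationRing A] [IsFractionRing A K] [IsDomain L]
    [ValuationRing L] (hπ : Function.Surjective π) : ValuationRing (compositeRing π) := by
  have key : ∀ (x y : compositeRing π) (c : L), (x : L) * c = y → x ∣ y ∨ y ∣ x := by
    intro x y c hc
    obtain ⟨a, ha⟩ | ⟨a, ha⟩ := ValuationRing.isInteger_or_isInteger A (π c)
    · left
      have hcS : c ∈ compositeRing π := by
        rw [Subalgebra.mem_comap, ← ha]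
        exact algebraMap_mem _ a
      exact ⟨⟨c, hcS⟩, Subtype.ext hc.symm⟩
    · by_cases h0 : π c = 0
      · exact .inl ⟨⟨c, mem_of_map_eq_zero π h0⟩, Subtype.ext hc.symm⟩
      right
      obtain ⟨d, hd⟩ := (isUnit_of_map_ne_zero π hπ h0).exists_right_inv
      have hd' : π d = algebraMap A K a := by
        rw [ha]
        exact eq_inv_of_mul_eq_one_right (by rw [← map_mul, hd, map_one])
      have hdS : d ∈ compositeRing π := by
        rw [Subalgebra.mem_comap, hd']
        exact algebraMap_mem _ a
      refine ⟨⟨d, hdS⟩, Subtype.ext ?_⟩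
      simp [← hc, mul_assoc, hd]
  rw [ValuationRing.iff_dvd_total]
  refine ⟨fun x y => ?_⟩
  obtain ⟨c, hc⟩ | ⟨c, hc⟩ := ValuationRing.dvd_total (x : L) y
  · exact key x y c hc.symm
  · exact (key y x c hc.symm).symm

section ToBase

variable [FaithfulSMul A K]

/-- The map from the pullback to `A`. -/
def toBase : compositeRing π →ₐ[A] A :=
  (Algebra.botEquivOfInjective (FaithfulSMul.algebraMap_injective A K)).toAlgHom.comp
    ((π.comp (compositeRing π).val).codRestrict ⊥ fun x => x.2)

lemma algebraMap_toBase (x : compositeRing π) : algebraMap A K (toBase π x) = π x := by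
  have h := (Algebra.botEquivOfInjective (FaithfulSMul.algebraMap_injective A K)).symm_apply_apply
    ((π.comp (compositeRing π).val).codRestrict ⊥ (fun x => x.2) x)
  exact congrArg Subtype.val h

lemma toBase_algebraMap (a : A) : toBase π (algebraMap A _ a) = a :=
  AlgHom.commutes _ a

lemma toBase_surjective : Function.Surjective (toBase π) :=
  fun a => ⟨algebraMap A _ a, toBase_algebraMap π a⟩

lemma toBase_eq_zero_iff (x : compositeRing π) : toBase π x = 0 ↔ π x = 0 := by
  rw [← algebraMap_toBase, map_eq_zero_iff _ (FaithfulSMul.algebraMap_injective A K)]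

lemma isUnit_iff [IsLocalRing L] (hπ : Function.Surjective π) (x : compositeRing π) :
    IsUnit x ↔ IsUnit (toBase π x) := by
  refine ⟨fun h => h.map _, fun h => ?_⟩
  obtain ⟨b, hb⟩ := h.exists_right_inv
  have hx : π x ≠ 0 := by
    rw [← algebraMap_toBase]
    exact (h.map (algebraMap A K)).ne_zero
  obtain ⟨y, hy⟩ := (isUnit_of_map_ne_zero π hπ hx).exists_right_inv
  have hy' : π y = algebraMap A K b := by
    have h1 : π x * π y = π x * algebraMap A K b := by
      rw [← map_mul, hy, ← algebraMap_toBase, ← map_mul, hb, map_one, map_one]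
    exact mul_left_cancel₀ hx h1
  have hyS : y ∈ compositeRing π := by
    rw [Subalgebra.mem_comap, hy']
    exact algebraMap_mem _ b
  exact IsUnit.of_mul_eq_one ⟨y, hyS⟩ (Subtype.ext hy)

section DVR

variable [IsDomain L] [IsDiscreteValuationRing L]

lemma ker_toBase_le {p : Ideal (compositeRing π)} [p.IsPrime] (hp : p ≠ ⊥) :
    RingHom.ker (toBase π) ≤ p := by
  obtain ⟨x, hxp, hx0⟩ := Submodule.exists_mem_ne_zero_of_ne_bot hp
  intro y hy
  have hπy : π y = 0 := (toBase_eq_zero_iff π y).mp hy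
  have hyx : (y : L) ∈ (Ideal.span {(x : L)}).radical := by
    rw [Ideal.radical_eq_sInf, Submodule.mem_sInf]
    rintro q ⟨hxq, hq⟩
    have hxq' : (x : L) ∈ q := hxq (Ideal.mem_span_singleton_self _)
    have hq0 : q ≠ ⊥ := by
      rintro rfl
      exact hx0 (Subtype.ext hxq')
    have := hq.isMaximal hq0
    rw [IsLocalRing.eq_maximalIdeal this, IsLocalRing.mem_maximalIdeal]
    intro hu
    exact (hu.map π).ne_zero hπy
  obtain ⟨n, hn⟩ := hyx
  obtain ⟨m, hm⟩ := Ideal.mem_span_singleton'.mp hn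
  have hmy : m * (y : L) ∈ compositeRing π := mem_of_map_eq_zero π (by simp [hπy])
  have hpow : y ^ (n + 1) = ⟨m * (y : L), hmy⟩ * x := by
    apply Subtype.ext
    push_cast
    rw [pow_succ, ← hm]
    ring
  exact Ideal.IsPrime.mem_of_pow_mem ‹_› (n + 1) (hpow ▸ p.mul_mem_left _ hxp)

lemma ker_toBase_ne_bot (hπ : Function.Surjective π) : RingHom.ker (toBase π) ≠ ⊥ := by
  obtain ⟨t, ht⟩ := IsDiscreteValuationRing.exists_irreducible L
  have h0 : π t = 0 := by
    by_contra h
    exact ht.not_isUnit (isUnit_of_map_ne_zero π hπ h)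
  intro hbot
  have hmem : (⟨t, mem_of_map_eq_zero π h0⟩ : compositeRing π) ∈ RingHom.ker (toBase π) :=
    (toBase_eq_zero_iff π _).mpr h0
  rw [hbot] at hmem
  exact ht.ne_zero (congrArg Subtype.val hmem)

/-- The spectrum of the pullback is that of `A` with a new generic point. -/
def primeSpectrumOrderIso [IsDomain A] (hπ : Function.Surjective π) :
    WithBot (PrimeSpectrum A) ≃o PrimeSpectrum (compositeRing π) :=
  have hne (p : PrimeSpectrum A) :
      ¬ PrimeSpectrum.comap (toBase π).toRingHom p ≤ ⊥ := fun h =>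
    ker_toBase_ne_bot π hπ (le_bot_iff.mp ((Ideal.comap_mono bot_le).trans h))
  RelIso.ofSurjective
    (OrderEmbedding.ofMapLEIff
      (fun q : WithBot (PrimeSpectrum A) =>
        q.recBotCoe ⊥ (PrimeSpectrum.comap (toBase π).toRingHom)) (by
      intro a b
      induction a using WithBot.recBotCoe with
      | bot => simp
      | coe a =>
        induction b using WithBot.recBotCoe with
        | bot => simpa using hne a
        | coe b =>
          rw [WithBot.coe_le_coe]
          exact Ideal.comap_le_comap_iff_of_surjective _ (toBase_surjective π) _ _))
    (by
      intro p
      by_cases hp : p.asIdeal = ⊥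
      · exact ⟨⊥, PrimeSpectrum.ext hp.symm⟩
      · have hker := ker_toBase_le π hp
        refine ⟨((⟨p.asIdeal.map (toBase π).toRingHom,
          Ideal.map_isPrime_of_surjective (toBase_surjective π) hker⟩ : PrimeSpectrum A) :
          WithBot _), PrimeSpectrum.ext ?_⟩
        exact (Ideal.comap_map_of_surjective' _ (toBase_surjective π) _).trans
          (sup_eq_left.mpr hker))

lemma ringKrullDim_eq [IsDomain A] (hπ : Function.Surjective π) :
    ringKrullDim (compositeRing π) = ringKrullDim A + 1 := by
  rw [ringKrullDim, ← Order.krullDim_eq_of_orderIso (primeSpectrumOrderIso π hπ),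
    Order.krullDim_withBot, ringKrullDim]

end DVR

end ToBase

end compositeRing

lemma eTrdeg_eq_toENat_trdeg (R A : Type*) [CommRing R] [CommRing A] [Algebra R A] :
    eTrdeg R A = Cardinal.toENat (Algebra.trdeg R A) :=
  rfl

lemma idealHt_eq_height {R : Type*} [CommRing R] (p : PrimeSpectrum R) :
    idealHt p.asIdeal = Order.height p :=
  le_antisymm (iInf_le (fun P : {P : PrimeSpectrum R // p.asIdeal ≤ P.asIdeal} =>
    Order.height P.1) ⟨p, le_rfl⟩) (le_iInf fun P => Order.height_mono P.2)

lemma eTrdeg_congr {k A B : Type} [CommRing k] [CommRing A] [CommRing B] [Algebra k A]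
    [Algebra k B] (e : A ≃ₐ[k] B) : eTrdeg k A = eTrdeg k B := by
  rw [eTrdeg_eq_toENat_trdeg, eTrdeg_eq_toENat_trdeg, e.trdeg_eq]

namespace compositeRing

lemma trdeg_eq_one {A K L : Type} [CommRing A] [Field K] [Algebra A K]
    [IsDomain A] [IsFractionRing A K] [CommRing L] [IsDomain L] [Algebra A L]
    [Algebra K[X] L] [Algebra K L] [IsScalarTower A K L] [IsScalarTower K K[X] L]
    (M : Submonoid K[X]) [IsLocalization M L] [FaithfulSMul K[X] L]
    (π : L →ₐ[A] K) (hX : π (algebraMap K[X] L X) = 0) :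
    Algebra.trdeg A (compositeRing π) = 1 := by
  have : Algebra.IsAlgebraic K[X] L := IsLocalization.isAlgebraic _ M
  have : Algebra.IsAlgebraic A K := IsLocalization.isAlgebraic _ (nonZeroDivisors A)
  have : FaithfulSMul A K := (faithfulSMul_iff_algebraMap_injective _ _).mpr
    (IsFractionRing.injective A K)
  have hL : Algebra.trdeg A L = 1 := by
    rw [← trdeg_add_eq A K, ← trdeg_add_eq K K[X] (A := L)]
    simp [Polynomial.trdeg_of_isDomain, trdeg_eq_zero (R := A) (A := K),
      trdeg_eq_zero (R := K[X]) (A := L)]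
  have : FaithfulSMul A L := (faithfulSMul_iff_algebraMap_injective _ _).mpr (by
    rw [IsScalarTower.algebraMap_eq A K L]
    exact (algebraMap K L).injective.comp (IsFractionRing.injective A K))
  apply le_antisymm
  · rw [← hL]
    exact trdeg_le_of_injective (compositeRing π).val Subtype.val_injective
  · rw [Cardinal.one_le_iff_pos]
    have hXt : Transcendental A (algebraMap K[X] L X) := by
      refine Transcendental.restrictScalars (S := K) (IsFractionRing.injective A K) ?_
      exact (transcendental_algebraMap_iff (FaithfulSMul.algebraMap_injective K[X] L)).mpr
        (Polynomial.transcendental_X K)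
    have : Algebra.Transcendental A (compositeRing π) :=
      ⟨⟨⟨algebraMap K[X] L X, mem_of_map_eq_zero π hX⟩, fun h => hXt
        (h.algHom (compositeRing π).val)⟩⟩
    exact trdeg_pos A _

end compositeRing

lemma eTrdeg_eq_add_one {k A : Type} [Field k] [CommRing A] [IsDomain A] [Algebra k A]
    {S : Type} [CommRing S] [IsDomain S] [Algebra k S] [Algebra A S] [IsScalarTower k A S]
    [FaithfulSMul A S] (h : Algebra.trdeg A S = 1) : eTrdeg k S = eTrdeg k A + 1 := by
  rw [eTrdeg_eq_toENat_trdeg, eTrdeg_eq_toENat_trdeg, ← trdeg_add_eq k A (A := S), h, map_add,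
    map_one]

namespace compositeRing

lemma isAFDomain {k A K L : Type} [Field k] [CommRing A] [IsDomain A] [Field K] [Algebra A K]
    [FaithfulSMul A K] [CommRing L] [Algebra A L] [IsDomain L] [IsDiscreteValuationRing L]
    [Algebra k A] [Algebra k L] [IsScalarTower k A L] (π : L →ₐ[A] K)
    (hπ : Function.Surjective π) (htr : eTrdeg k (compositeRing π) = eTrdeg k A + 1)
    (hA : IsAFDomain k A) : IsAFDomain k (compositeRing π) := by
  intro p hp
  obtain ⟨q, hq⟩ := (primeSpectrumOrderIso π hπ).surjective ⟨p, hp⟩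
  have hht : idealHt p = Order.height q := by
    rw [← Order.height_orderIso (primeSpectrumOrderIso π hπ) q, hq]
    exact idealHt_eq_height ⟨p, hp⟩
  induction q using WithBot.recBotCoe with
  | bot =>
    have hp0 : p = ⊥ := congrArg PrimeSpectrum.asIdeal hq.symm
    subst hp0
    rw [hht, Order.height_bot, zero_add]
    exact eTrdeg_congr (AlgEquiv.quotientBot k (compositeRing π))
  | coe q =>
    have hpq : p = q.asIdeal.comap (toBase π) := congrArg PrimeSpectrum.asIdeal hq.symm
    have e : (compositeRing π ⧸ p) ≃ₐ[k] A ⧸ q.asIdeal := by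
      let f : compositeRing π →ₐ[k] A ⧸ q.asIdeal :=
        (Ideal.Quotient.mkₐ k q.asIdeal).comp ((toBase π).restrictScalars k)
      have hf : Function.Surjective f :=
        Ideal.Quotient.mk_surjective.comp (toBase_surjective π)
      have hker : p = RingHom.ker f := by
        rw [hpq]
        ext x
        exact (Ideal.Quotient.eq_zero_iff_mem (I := q.asIdeal)).symm
      exact (Ideal.quotientEquivAlgOfEq k hker).trans
        (Ideal.quotientKerAlgEquivOfSurjective hf)
    rw [hht, Order.height_coe_withBot, eTrdeg_congr e, htr, ← hA q.asIdeal q.isPrime,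
      idealHt_eq_height]
    ring

end compositeRing

attribute [instance] AFValuationWitness.commRing AFValuationWitness.isDomain
  AFValuationWitness.algebra AFValuationWitness.valuationRing

/-- Pulling the valuation ring of a witness back along a surjection from a discrete valuation
ring onto its fraction field raises the Krull dimension by one. -/
def AFValuationWitness.pullback {k : Type} [Field k] {r : ℕ} (W : AFValuationWitness k r)
    {K L : Type} [Field K] [Algebra W.V K] [IsFractionRing W.V K] [FaithfulSMul W.V K]
    [CommRing L] [IsDomain L] [IsDiscreteValuationRing L] [Algebra W.V L] [Algebra k L]
    [IsScalarTower k W.V L] (π : L →ₐ[W.V] K) (hπ : Function.Surjective π)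
    (htr : Algebra.trdeg W.V (compositeRing π) = 1) : AFValuationWitness k (r + 1) :=
  have hinj : Function.Injective (algebraMap W.V (compositeRing π)) :=
    Function.LeftInverse.injective (compositeRing.toBase_algebraMap π)
  have : FaithfulSMul W.V (compositeRing π) :=
    (faithfulSMul_iff_algebraMap_injective _ _).mpr hinj
  have htr' : eTrdeg k (compositeRing π) = eTrdeg k W.V + 1 := eTrdeg_eq_add_one htr
  have : ValuationRing (compositeRing π) := compositeRing.valuationRing π hπ
  have hmem (x : compositeRing π) : x ∈ IsLocalRing.maximalIdeal (compositeRing π) ↔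
      compositeRing.toBase π x ∈ IsLocalRing.maximalIdeal W.V := by
    simp only [IsLocalRing.mem_maximalIdeal, mem_nonunits_iff, compositeRing.isUnit_iff π hπ]
  { V := compositeRing π
    finite_trdeg := by
      rw [htr']
      exact WithTop.add_ne_top.mpr ⟨W.finite_trdeg, WithTop.one_ne_top⟩
    dim_eq := by
      rw [compositeRing.ringKrullDim_eq π hπ, W.dim_eq]
      push_cast
      rfl
    af := compositeRing.isAFDomain π hπ htr' W.af
    K := W.K.map (algebraMap W.V (compositeRing π))
    K_isField := (W.K.equivMapOfInjective _ hinj).symm.toMulEquiv.isField W.K_isField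
    add_decomp := fun v => by
      obtain ⟨c, hc, hvc⟩ := W.add_decomp (compositeRing.toBase π v)
      refine ⟨algebraMap W.V _ c, ⟨c, hc, rfl⟩, ?_⟩
      rwa [hmem, map_sub, compositeRing.toBase_algebraMap]
    inter_eq_bot := by
      rintro _ ⟨c, hc, rfl⟩ h
      rw [hmem, compositeRing.toBase_algebraMap] at h
      rw [W.inter_eq_bot c hc h, map_zero] }

/-- Evaluation at zero, on the localization of `K[X]` at the prime ideal `(X)`. -/
lemma exists_eval_zero_localization (K L : Type*) [Field K] [CommRing L] [Algebra K[X] L]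
    [Algebra K L] [IsScalarTower K K[X] L] (P : Ideal K[X]) [P.IsPrime]
    (hP : P = Ideal.span {X}) [IsLocalization.AtPrime L P] :
    ∃ π : L →ₐ[K] K, Function.Surjective π ∧ π (algebraMap K[X] L X) = 0 := by
  have hev (y : P.primeCompl) : IsUnit (aeval (0 : K) (y : K[X])) := by
    rw [isUnit_iff_ne_zero]
    intro h
    refine y.2 (hP.ge (Ideal.mem_span_singleton.mpr (X_dvd_iff.mpr ?_)))
    rwa [coeff_zero_eq_aeval_zero]
  refine ⟨IsLocalization.liftAlgHom (M := P.primeCompl) hev, fun a => ⟨algebraMap K L a, ?_⟩, ?_⟩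
  · exact AlgHom.commutes _ a
  · exact (IsLocalization.lift_eq (M := P.primeCompl) hev X).trans (aeval_X 0)

/-- The pullback of a witness along `K[X]_(X) → K`, with `K` its fraction field. -/
lemma AFValuationWitness.nonempty_succ_of_localization {k : Type} [Field k] {r : ℕ}
    (W : AFValuationWitness k r) (K L : Type) [Field K] [Algebra W.V K] [IsFractionRing W.V K]
    [CommRing L] [IsDomain L] [Algebra K[X] L] [Algebra K L] [IsScalarTower K K[X] L]
    [Algebra W.V L] [IsScalarTower W.V K L] [Algebra k L] [IsScalarTower k W.V L]
    (P : Ideal K[X]) [P.IsPrime] (hP : P = Ideal.span {X}) [IsLocalization.AtPrime L P] :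
    Nonempty (AFValuationWitness k (r + 1)) := by
  have hP0 : P ≠ ⊥ := by simp [hP]
  have : IsDiscreteValuationRing L :=
    IsLocalization.AtPrime.isDiscreteValuationRing_of_dedekind_domain K[X] hP0 L
  have : FaithfulSMul K[X] L := (faithfulSMul_iff_algebraMap_injective _ _).mpr
    (IsLocalization.injective L P.primeCompl_le_nonZeroDivisors)
  have : FaithfulSMul W.V K := (faithfulSMul_iff_algebraMap_injective _ _).mpr
    (IsFractionRing.injective W.V K)
  obtain ⟨π, hπ, hX⟩ := exists_eval_zero_localization K L P hP
  exact ⟨W.pullback (π.restrictScalars W.V) hπ (compositeRing.trdeg_eq_one P.primeCompl _ hX)⟩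

lemma AFValuationWitness.nonempty_succ {k : Type} [Field k] {r : ℕ}
    (W : AFValuationWitness k r) : Nonempty (AFValuationWitness k (r + 1)) := by
  let P : Ideal (FractionRing W.V)[X] := Ideal.span {X}
  have : P.IsPrime := (Ideal.span_singleton_prime X_ne_zero).mpr prime_X
  have : IsDomain (Localization.AtPrime P) :=
    IsLocalization.isDomain_localization P.primeCompl_le_nonZeroDivisors
  exact W.nonempty_succ_of_localization (FractionRing W.V) (Localization.AtPrime P) P rfl

lemma isAFDomain_self (k : Type) [Field k] : IsAFDomain k k := by
  intro p hp
  have hp0 : p = ⊥ := (Ideal.eq_bot_or_top p).resolve_right hp.ne_top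
  subst hp0
  have hht : idealHt (⊥ : Ideal k) = 0 :=
    (idealHt_eq_height (⊥ : PrimeSpectrum k)).trans (Order.height_bot _)
  rw [hht, zero_add]
  exact eTrdeg_congr (AlgEquiv.quotientBot k k)

/-- The field `k` itself, as a valuation ring of dimension zero. -/
def AFValuationWitness.zero (k : Type) [Field k] : AFValuationWitness k 0 where
  V := k
  finite_trdeg := by simp [eTrdeg_eq_toENat_trdeg, trdeg_eq_zero]
  dim_eq := by simp
  af := isAFDomain_self k
  K := ⊤
  K_isField := Subring.topEquiv.toMulEquiv.isField (Field.toIsField k)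
  add_decomp v := ⟨v, trivial, by simp⟩
  inter_eq_bot c _ hc := by simpa using hc

end CompositeRing

/-- for every field `k` and every positive integer `r` there exists such a
valuation domain `V = K + M` of dimension `r` which is an AF-domain over `k`. -/
theorem stmt_19 (k : Type) [Field k] (r : ℕ) (hr : 0 < r) :
    Nonempty (AFValuationWitness k r) := by
  clear hr
  induction r with
  | zero => exact ⟨.zero k⟩
  | succ r ih => exact ih.elim AFValuationWitness.nonempty_succ
end
end
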